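/- arXiv:2603.19215 — 2 statements merged into one kernel-verified Lean document; each statement's English description precedes it below -/
import Mathlib

section
/- Let k be a finite field and let F be a homogeneous cubic form in the 4 variables T₀,T₁,T₂,T₃ over k defining a smooth cubic surface V. For every integer n ≥ 1 there exists an integer j ≥ 0 such that, letting K be the field extension of k of degree 2^j (the top of a tower of j quadratic extensions of k), for any n points P₁, …, Pₙ of V over K there exists a point P′ of V over K that is in general position with each of P₁, …, Pₙ simultaneously. -/
open MvPolynomial

/-- Two points `P`, `P'` of the cubic surface `F = 0` are *in general position*:
writing the binary form `F(s•P + t•P')` in variables `s, t` (which, since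
`F(P) = F(P') = 0`, is of the shape `c₁ s²t + c₂ s t²`), both coefficients
`c₁` (of `s²t`) and `c₂` (of `s t²`) are nonzero. -/
def InGeneralPosition {k : Type*} [CommRing k] (F : MvPolynomial (Fin 4) k)
    (P P' : Fin 4 → k) : Prop :=
  (MvPolynomial.eval₂ MvPolynomial.C
      (fun i => MvPolynomial.C (P i) * MvPolynomial.X 0 +
        MvPolynomial.C (P' i) * MvPolynomial.X (1 : Fin 2)) F).coeff
      (Finsupp.single 0 2 + Finsupp.single 1 1) ≠ 0 ∧
  (MvPolynomial.eval₂ MvPolynomial.C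
      (fun i => MvPolynomial.C (P i) * MvPolynomial.X 0 +
        MvPolynomial.C (P' i) * MvPolynomial.X (1 : Fin 2)) F).coeff
      (Finsupp.single 0 1 + Finsupp.single 1 2) ≠ 0

/-- The surface `F = 0` is smooth: `F` together with its four partial derivatives
has no common nonzero zero over an algebraic closure of `k`. -/
def IsSmoothCubicSurface {k : Type*} [Field k] (F : MvPolynomial (Fin 4) k) : Prop :=
  ∀ x : Fin 4 → AlgebraicClosure k, x ≠ 0 →
    ¬ (MvPolynomial.eval x (MvPolynomial.map (algebraMap k (AlgebraicClosure k)) F) = 0 ∧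
      ∀ i : Fin 4, MvPolynomial.eval x
        (MvPolynomial.map (algebraMap k (AlgebraicClosure k)) (MvPolynomial.pderiv i F)) = 0)

/-! ### Polarization -/

lemma lin_expand {R S : Type*} [CommRing R] [CommRing S] (φ : R →+* S)
    {l : MvPolynomial (Fin 4) R} (hl : l ∈ homogeneousSubmodule (Fin 4) R 1)
    (P P' : Fin 4 → S) (x y : S) :
    eval₂ φ (fun i => x * P i + y * P' i) l = x * eval₂ φ P l + y * eval₂ φ P' l ∧
    ∑ j, P' j * eval₂ φ P (pderiv j l) = eval₂ φ P' l := by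
  rw [homogeneousSubmodule_one_eq_span_X] at hl
  induction hl using Submodule.span_induction with
  | mem l h =>
    obtain ⟨i, rfl⟩ := h
    refine ⟨by simp, ?_⟩
    simp only [eval₂_X]
    rw [Finset.sum_eq_single i]
    · simp
    · intro b _ hb
      rw [pderiv_X_of_ne (Ne.symm hb)]; simp
    · simp
  | zero => simp
  | add u v _ _ hu hv =>
    refine ⟨by simp only [eval₂_add, hu.1, hv.1]; ring, ?_⟩
    simp only [map_add, eval₂_add, mul_add, Finset.sum_add_distrib, hu.2, hv.2]
  | smul c u _ hu =>
    refine ⟨by simp only [smul_eq_C_mul, eval₂_mul, eval₂_C, hu.1]; ring, ?_⟩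
    rw [smul_eq_C_mul, eval₂_mul, eval₂_C, ← hu.2, Finset.mul_sum]
    refine Finset.sum_congr rfl fun j _ => ?_
    rw [pderiv_C_mul, eval₂_mul, eval₂_C]; ring

lemma pol_mul {R S : Type*} [CommRing R] [CommRing S] (φ : R →+* S)
    (G H : MvPolynomial (Fin 4) R) (P P' : Fin 4 → S) :
    ∑ j, P' j * eval₂ φ P (pderiv j (G * H)) =
      (∑ j, P' j * eval₂ φ P (pderiv j G)) * eval₂ φ P H +
      eval₂ φ P G * (∑ j, P' j * eval₂ φ P (pderiv j H)) := by
  rw [Finset.sum_mul, Finset.mul_sum, ← Finset.sum_add_distrib]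
  refine Finset.sum_congr rfl fun j _ => ?_
  rw [pderiv_mul, eval₂_add, eval₂_mul, eval₂_mul]; ring

lemma pol_add {R S : Type*} [CommRing R] [CommRing S] (φ : R →+* S)
    (G H : MvPolynomial (Fin 4) R) (P P' : Fin 4 → S) :
    ∑ j, P' j * eval₂ φ P (pderiv j (G + H)) =
      (∑ j, P' j * eval₂ φ P (pderiv j G)) + ∑ j, P' j * eval₂ φ P (pderiv j H) := by
  rw [← Finset.sum_add_distrib]
  refine Finset.sum_congr rfl fun j _ => ?_
  rw [map_add, eval₂_add]; ring

lemma quad_expand {R S : Type*} [CommRing R] [CommRing S] (φ : R →+* S)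
    {Q : MvPolynomial (Fin 4) R} (hQ : Q ∈ homogeneousSubmodule (Fin 4) R 2)
    (P P' : Fin 4 → S) (x y : S) :
    eval₂ φ (fun i => x * P i + y * P' i) Q = x ^ 2 * eval₂ φ P Q +
      x * y * (∑ j, P' j * eval₂ φ P (pderiv j Q)) + y ^ 2 * eval₂ φ P' Q ∧
    ∑ j, P' j * eval₂ φ P (pderiv j Q) = ∑ j, P j * eval₂ φ P' (pderiv j Q) := by
  rw [← homogeneousSubmodule_one_pow, pow_two] at hQ
  induction hQ using Submodule.mul_induction_on' with
  | mem_mul_mem u hu v hv =>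
    have h1 := lin_expand φ hu P P' x y
    have h2 := lin_expand φ hv P P' x y
    have h3 := lin_expand φ hu P' P x y
    have h4 := lin_expand φ hv P' P x y
    rw [pol_mul, pol_mul, h1.2, h2.2, h3.2, h4.2]
    simp only [eval₂_mul, h1.1, h2.1]
    constructor <;> ring
  | add u _ v _ hu hv =>
    rw [pol_add, pol_add, eval₂_add, eval₂_add, eval₂_add, hu.1, hv.1, ← hu.2, ← hv.2]
    constructor <;> ring

lemma cubic_expand {R S : Type*} [CommRing R] [CommRing S] (φ : R →+* S)
    {F : MvPolynomial (Fin 4) R} (hF : F ∈ homogeneousSubmodule (Fin 4) R 3)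
    (P P' : Fin 4 → S) (x y : S) :
    eval₂ φ (fun i => x * P i + y * P' i) F = x ^ 3 * eval₂ φ P F +
      x ^ 2 * y * (∑ j, P' j * eval₂ φ P (pderiv j F)) +
      x * y ^ 2 * (∑ j, P j * eval₂ φ P' (pderiv j F)) + y ^ 3 * eval₂ φ P' F := by
  rw [← homogeneousSubmodule_one_pow, pow_succ, homogeneousSubmodule_one_pow] at hF
  induction hF using Submodule.mul_induction_on' with
  | mem_mul_mem u hu v hv =>
    have h1 := quad_expand φ hu P P' x y
    have h2 := lin_expand φ hv P P' x y
    have h4 := lin_expand φ hv P' P x y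
    rw [pol_mul, pol_mul, h2.2, h4.2, ← h1.2]
    simp only [eval₂_mul, h1.1, h2.1]
    ring
  | add u _ v _ hu hv =>
    rw [pol_add, pol_add, eval₂_add, eval₂_add, eval₂_add, hu, hv]
    ring

lemma eval₂_C_comp {R : Type*} [CommRing R] (G : MvPolynomial (Fin 4) R) (P : Fin 4 → R) :
    eval₂ (C : R →+* MvPolynomial (Fin 2) R) (fun i => C (P i)) G = C (eval P G) := by
  have := eval₂_comp_left (C : R →+* MvPolynomial (Fin 2) R) (RingHom.id R) P G
  rw [← eval₂_id, this]; rfl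

lemma inGeneralPosition_iff {R : Type*} [CommRing R] {F : MvPolynomial (Fin 4) R}
    (hF : F.IsHomogeneous 3) (P P' : Fin 4 → R) :
    InGeneralPosition F P P' ↔ (∑ j, P' j * eval P (pderiv j F)) ≠ 0 ∧
      (∑ j, P j * eval P' (pderiv j F)) ≠ 0 := by
  have h := cubic_expand (C : R →+* MvPolynomial (Fin 2) R) hF
    (fun i => C (P i)) (fun i => C (P' i)) (X 0) (X 1)
  simp only [eval₂_C_comp, ← C_mul, ← map_sum] at h
  have h' : eval₂ (C : R →+* MvPolynomial (Fin 2) R)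
      (fun i => C (P i) * X 0 + C (P' i) * X 1) F =
      monomial (Finsupp.single 0 3) (eval P F) +
      monomial (Finsupp.single 0 2 + Finsupp.single 1 1) (∑ j, P' j * eval P (pderiv j F)) +
      monomial (Finsupp.single 0 1 + Finsupp.single 1 2) (∑ j, P j * eval P' (pderiv j F)) +
      monomial (Finsupp.single 1 3) (eval P' F) := by
    simp only [mul_comm (C _) (X _)]
    rw [h]
    generalize (∑ j, P' j * eval P (pderiv j F)) = u
    generalize (∑ j, P j * eval P' (pderiv j F)) = v
    have key : ∀ (d e : Fin 2 →₀ ℕ) (r : R), (monomial (d + e) r : MvPolynomial (Fin 2) R) =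
        C r * (monomial d 1 * monomial e 1) := by
      intro d e r
      rw [monomial_mul, C_mul_monomial]; simp
    have key' : ∀ (d : Fin 2 →₀ ℕ) (r : R), (monomial d r : MvPolynomial (Fin 2) R) =
        C r * monomial d 1 := by
      intro d r
      rw [C_mul_monomial]; simp
    rw [key, key, key' _ (eval P F), key' _ (eval P' F)]
    simp only [← X_pow_eq_monomial]
    ring
  unfold InGeneralPosition
  rw [h']
  generalize (∑ j, P' j * eval P (pderiv j F)) = u
  generalize (∑ j, P j * eval P' (pderiv j F)) = v
  have e1 : (Finsupp.single 0 3 : Fin 2 →₀ ℕ) ≠ Finsupp.single 0 2 + Finsupp.single 1 1 := by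
    intro h; simpa using DFunLike.congr_fun h 1
  have e2 : (Finsupp.single 0 3 : Fin 2 →₀ ℕ) ≠ Finsupp.single 0 1 + Finsupp.single 1 2 := by
    intro h; simpa using DFunLike.congr_fun h 1
  have e3 : (Finsupp.single 1 3 : Fin 2 →₀ ℕ) ≠ Finsupp.single 0 2 + Finsupp.single 1 1 := by
    intro h; simpa using DFunLike.congr_fun h 0
  have e4 : (Finsupp.single 1 3 : Fin 2 →₀ ℕ) ≠ Finsupp.single 0 1 + Finsupp.single 1 2 := by
    intro h; simpa using DFunLike.congr_fun h 0
  have e5 : (Finsupp.single 0 2 + Finsupp.single 1 1 : Fin 2 →₀ ℕ) ≠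
      Finsupp.single 0 1 + Finsupp.single 1 2 := by
    intro h; simpa using DFunLike.congr_fun h 0
  simp [coeff_monomial, e1, e2, e3, e4, e5, e5.symm]

/-! ### Three forms in four variables over an algebraically closed field -/

lemma four_le_height {Ω : Type*} [Field Ω] :
    (4 : ℕ∞) ≤ (vanishingIdeal Ω {(0 : Fin 4 → Ω)}).height := by
  let f : ℕ → (MvPolynomial (Fin 4) Ω →ₐ[Ω] MvPolynomial (Fin 4) Ω) := fun i =>
    aeval (fun j : Fin 4 => if j.val < i then 0 else X j)
  let J : ℕ → Ideal (MvPolynomial (Fin 4) Ω) := fun i => RingHom.ker (f i)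
  have hJ : ∀ i, (J i).IsPrime := fun i => RingHom.ker_isPrime _
  have hcomp : ∀ i, f (i + 1) = (f (i + 1)).comp (f i) := by
    intro i
    apply MvPolynomial.algHom_ext
    intro j
    simp only [f, AlgHom.comp_apply, aeval_X]
    by_cases h : j.val < i
    · simp [h, Nat.lt_succ_of_lt h]
    · simp [h]
  have hlt : ∀ i, i < 4 → J i < J (i + 1) := by
    intro i hi
    refine lt_of_le_of_ne ?_ ?_
    · intro p hp
      change f (i + 1) p = 0
      rw [hcomp, AlgHom.comp_apply, show f i p = 0 from hp, map_zero]
    · intro h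
      have h1 : (X ⟨i, hi⟩ : MvPolynomial (Fin 4) Ω) ∈ J (i + 1) := by
        change f (i + 1) _ = 0
        simp [f]
      rw [← h] at h1
      have h2 : f i (X ⟨i, hi⟩) = 0 := h1
      simp [f] at h2
  have hh : ∀ i : ℕ, i ≤ 4 → (i : ℕ∞) ≤ (J i).height := by
    intro i
    induction i with
    | zero => simp
    | succ i ih =>
      intro hi
      have := hJ i
      have := hJ (i + 1)
      have h1 := Ideal.height_add_one_le_of_lt_of_isPrime (hlt i (by omega))
      refine le_trans ?_ h1
      push_cast
      gcongr
      exact ih (by omega)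
  refine (hh 4 le_rfl).trans (Ideal.height_mono ?_)
  intro p hp
  rw [mem_vanishingIdeal_singleton_iff]
  have h1 : f 4 p = 0 := hp
  have h2 : (aeval (0 : Fin 4 → Ω)).comp (f 4) = aeval (0 : Fin 4 → Ω) := by
    apply MvPolynomial.algHom_ext
    intro j
    simp [f]
  rw [← h2, AlgHom.comp_apply, h1, map_zero]

lemma three_forms {Ω : Type*} [Field Ω] [IsAlgClosed Ω] (q : Fin 3 → MvPolynomial (Fin 4) Ω)
    (h0 : ∀ i, eval 0 (q i) = 0) : ∃ x : Fin 4 → Ω, x ≠ 0 ∧ ∀ i, eval x (q i) = 0 := by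
  by_contra hcon
  push Not at hcon
  set I := Ideal.span (Set.range q) with hI
  have hZ : zeroLocus Ω I ⊆ {0} := by
    intro x hx
    by_contra hx0
    obtain ⟨i, hi⟩ := hcon x hx0
    exact hi (by simpa [aeval_eq_eval] using hx (q i) (Ideal.subset_span ⟨i, rfl⟩))
  have hmin : vanishingIdeal Ω {(0 : Fin 4 → Ω)} ∈ I.minimalPrimes := by
    refine ⟨⟨inferInstance, ?_⟩, ?_⟩
    · rw [hI, Ideal.span_le]
      rintro _ ⟨i, rfl⟩
      rw [SetLike.mem_coe, mem_vanishingIdeal_singleton_iff]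
      simpa [aeval_eq_eval] using h0 i
    · rintro p ⟨hp, hIp⟩ _
      have h1 : I.radical ≤ p := hp.radical_le_iff.mpr hIp
      rw [← vanishingIdeal_zeroLocus_eq_radical (K := Ω)] at h1
      exact (vanishingIdeal_anti_mono hZ).trans h1
  have h3 := Ideal.height_le_card_of_mem_minimalPrimes_span (Set.finite_range q) hmin
  have h4 := four_le_height (Ω := Ω)
  have h5 : (Set.range q).ncard ≤ 3 := by
    have := Set.ncard_image_le (f := q) (Set.finite_univ)
    simpa [Set.ncard_univ] using this
  have h6 : (4 : ℕ∞) ≤ ((3 : ℕ) : ℕ∞) := h4.trans (h3.trans (by exact_mod_cast h5))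
  exact absurd h6 (by decide)

lemma hom_eval_zero {R : Type*} [CommRing R] {G : MvPolynomial (Fin 4) R} {d : ℕ}
    (hG : G.IsHomogeneous d) (hd : d ≠ 0) : eval 0 G = 0 := by
  rw [eval_zero, constantCoeff_eq]
  exact hG.coeff_eq_zero (by simpa using hd.symm)

lemma polar_ne_zero {Ω : Type*} [Field Ω] [IsAlgClosed Ω] {F : MvPolynomial (Fin 4) Ω}
    (hF : F.IsHomogeneous 3)
    (hs : ∀ x : Fin 4 → Ω, x ≠ 0 → eval x F = 0 → (∀ i, eval x (pderiv i F) = 0) → False)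
    {P : Fin 4 → Ω} (hP : P ≠ 0) (hPF : eval P F = 0) :
    ∑ j, C (P j) * pderiv j F ≠ 0 := by
  intro hQ
  have hQ' : ∀ D : Fin 4 → Ω, ∑ j, P j * eval D (pderiv j F) = 0 := by
    intro D
    simpa using congrArg (eval D) hQ
  by_cases h2 : (2 : Ω) = 0
  · obtain ⟨j0, hj0⟩ := Function.ne_iff.mp hP
    obtain ⟨x, hx, hxq⟩ := three_forms (fun i => pderiv (j0.succAbove i) F) (by
      intro i
      exact hom_eval_zero (hF.pderiv (i := j0.succAbove i)) (by norm_num))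
    have h1 := hQ' x
    rw [Fin.sum_univ_succAbove _ j0] at h1
    simp only [hxq, mul_zero, Finset.sum_const_zero, add_zero] at h1
    have h3 : eval x (pderiv j0 F) = 0 := by
      rcases mul_eq_zero.mp h1 with h | h
      · exact absurd h hj0
      · exact h
    have h4 : ∀ i, eval x (pderiv i F) = 0 := by
      intro i
      rcases eq_or_ne i j0 with rfl | hi
      · exact h3
      · obtain ⟨y, rfl⟩ := Fin.exists_succAbove_eq hi
        exact hxq y
    refine hs x hx ?_ h4
    have h5 := congrArg (eval x) hF.sum_X_mul_pderiv
    simp only [map_sum, map_mul, h4, mul_zero, Finset.sum_const_zero, nsmul_eq_mul, map_natCast] at h5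
    push_cast at h5
    linear_combination (-1 : Ω) * h5 - eval x F * h2
  · refine hs P hP hPF ?_
    have hL : ∀ D : Fin 4 → Ω, ∑ j, D j * eval P (pderiv j F) = 0 := by
      intro D
      have e1 := cubic_expand (RingHom.id Ω) hF P D 2 1
      have e2 := cubic_expand (RingHom.id Ω) hF P (fun i => 1 * P i + 1 * D i) 1 1
      have e3 := cubic_expand (RingHom.id Ω) hF P D 1 1
      simp only [eval₂_id, hQ', hPF] at e1 e2 e3
      rw [e3] at e2
      have e4 : ∑ j, (1 * P j + 1 * D j) * eval P (pderiv j F) =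
        ∑ j, D j * eval P (pderiv j F) := by
        rw [← zero_add (∑ j, D j * eval P (pderiv j F)), ← hQ' P, ← Finset.sum_add_distrib]
        exact Finset.sum_congr rfl fun j _ => by ring
      rw [e4] at e2
      have e5 : (fun i => 2 * P i + 1 * D i) = fun i => 1 * P i + 1 * (1 * P i + 1 * D i) := by
        funext i; ring
      rw [e5, e2] at e1
      have : (2 : Ω) * ∑ j, D j * eval P (pderiv j F) = 0 := by linear_combination - e1
      exact (mul_eq_zero.mp this).resolve_left h2
    intro i
    simpa [Pi.single_apply] using hL (Pi.single i 1)

/-! ### Irreducibility -/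

lemma hom_top_mul {R : Type*} [CommRing R] (G H : MvPolynomial (Fin 4) R) (a b : ℕ)
    (hG : G.totalDegree ≤ a) (hH : H.totalDegree ≤ b) :
    homogeneousComponent (a + b) (G * H) = homogeneousComponent a G * homogeneousComponent b H := by
  have hG' : G = ∑ i ∈ Finset.range (a + 1), homogeneousComponent i G := by
    conv_lhs => rw [← sum_homogeneousComponent G]
    refine Finset.sum_subset (Finset.range_mono (by omega)) fun i _ hi => ?_
    exact homogeneousComponent_eq_zero _ _ (by simpa using hi)
  have hH' : H = ∑ i ∈ Finset.range (b + 1), homogeneousComponent i H := by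
    conv_lhs => rw [← sum_homogeneousComponent H]
    refine Finset.sum_subset (Finset.range_mono (by omega)) fun i _ hi => ?_
    exact homogeneousComponent_eq_zero _ _ (by simpa using hi)
  have hc : ∀ i j, homogeneousComponent (a + b)
      (homogeneousComponent i G * homogeneousComponent j H) =
      if i + j = a + b then homogeneousComponent i G * homogeneousComponent j H else 0 := by
    intro i j
    rw [homogeneousComponent_of_mem (m := a + b) (n := i + j)
      ((homogeneousComponent_isHomogeneous i G).mul (homogeneousComponent_isHomogeneous j H))]
    simp only [eq_comm]
  conv_lhs => rw [hG', hH']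
  rw [Finset.sum_mul_sum, map_sum, Finset.sum_eq_single a]
  · rw [map_sum, Finset.sum_eq_single b]
    · rw [hc, if_pos rfl]
    · intro j _ hj
      rw [hc, if_neg (by omega)]
    · simp
  · intro i hi hia
    rw [map_sum]
    refine Finset.sum_eq_zero fun j hj => ?_
    simp only [Finset.mem_range] at hi hj
    rw [hc, if_neg (by omega)]
  · simp

lemma exists_common_zero {K : Type*} [Field K] [Fintype K] {G H : MvPolynomial (Fin 4) K}
    (h : G.totalDegree + H.totalDegree < 4) (hG : eval 0 G = 0) (hH : eval 0 H = 0) :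
    ∃ x : Fin 4 → K, x ≠ 0 ∧ eval x G = 0 ∧ eval x H = 0 := by
  classical
  obtain ⟨p, hp⟩ := CharP.exists K
  have hprime : p.Prime := CharP.char_is_prime K p
  have h1 := char_dvd_card_solutions_of_add_lt p (f₁ := G) (f₂ := H) (by simpa using h)
  have h2 : 0 < Fintype.card { x : Fin 4 → K // eval x G = 0 ∧ eval x H = 0 } :=
    Fintype.card_pos_iff.mpr ⟨⟨0, hG, hH⟩⟩
  have h3 : 1 < Fintype.card { x : Fin 4 → K // eval x G = 0 ∧ eval x H = 0 } :=
    lt_of_lt_of_le hprime.one_lt (Nat.le_of_dvd h2 h1)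
  have : Nontrivial { x : Fin 4 → K // eval x G = 0 ∧ eval x H = 0 } :=
    Fintype.one_lt_card_iff_nontrivial.mp h3
  obtain ⟨y, hy⟩ := exists_ne (⟨0, hG, hH⟩ : { x : Fin 4 → K // eval x G = 0 ∧ eval x H = 0 })
  exact ⟨y.1, fun h => hy (Subtype.ext h), y.2⟩

lemma cubic_irreducible {K : Type*} [Field K] [Fintype K] {F : MvPolynomial (Fin 4) K}
    (hF0 : F ≠ 0) (hF : F.IsHomogeneous 3)
    (hs : ∀ x : Fin 4 → K, x ≠ 0 → eval x F = 0 → (∀ i, eval x (pderiv i F) = 0) → False) :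
    Irreducible F := by
  have hunit : ∀ G : MvPolynomial (Fin 4) K, G ≠ 0 → G.totalDegree = 0 → IsUnit G := by
    intro G hG h
    rw [totalDegree_eq_zero_iff_eq_C] at h
    rw [h] at hG ⊢
    refine IsUnit.map C (isUnit_iff_ne_zero.mpr ?_)
    intro h0
    rw [h0] at hG
    simp at hG
  constructor
  · intro hu
    have := MvPolynomial.isUnit_iff_totalDegree_of_isReduced.mp hu
    rw [hF.totalDegree hF0] at this
    omega
  · intro G H hGH
    by_contra hcon
    push Not at hcon
    have hG0 : G ≠ 0 := by rintro rfl; simp at hGH; exact hF0 hGH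
    have hH0 : H ≠ 0 := by rintro rfl; simp at hGH; exact hF0 hGH
    have ha : G.totalDegree ≠ 0 := fun h => hcon.1 (hunit G hG0 h)
    have hb : H.totalDegree ≠ 0 := fun h => hcon.2 (hunit H hH0 h)
    have hab : G.totalDegree + H.totalDegree = 3 := by
      rw [← totalDegree_mul_of_isDomain hG0 hH0, ← hGH, hF.totalDegree hF0]
    have hFt : F = homogeneousComponent G.totalDegree G * homogeneousComponent H.totalDegree H := by
      rw [← hom_top_mul _ _ _ _ le_rfl le_rfl, ← hGH, hab, homogeneousComponent_eq_self hF]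
    have hg := homogeneousComponent_isHomogeneous G.totalDegree G
    have hh := homogeneousComponent_isHomogeneous H.totalDegree H
    obtain ⟨x, hx, h1, h2⟩ := exists_common_zero (lt_of_le_of_lt
      (add_le_add hg.totalDegree_le hh.totalDegree_le) (by omega))
      (hom_eval_zero hg ha) (hom_eval_zero hh hb)
    refine hs x hx ?_ ?_
    · rw [hFt, map_mul, h1, zero_mul]
    · intro i
      rw [hFt, pderiv_mul, map_add, map_mul, map_mul, h1, h2]; simp

/-! ### Elimination along the lines through a fixed point -/

lemma res_ne_zero {A : Type*} [CommRing A] [IsDomain A] (a b c α β γ : A) (ha : a ≠ 0)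
    (hf : Prime (Polynomial.C a * Polynomial.X ^ 2 + Polynomial.C b * Polynomial.X + Polynomial.C c))
    (hfg : ¬ (Polynomial.C a * Polynomial.X ^ 2 + Polynomial.C b * Polynomial.X + Polynomial.C c) ∣
      (Polynomial.C α * Polynomial.X ^ 2 + Polynomial.C β * Polynomial.X + Polynomial.C γ)) :
    a * (a * γ - c * α) ^ 2 - b * (a * β - b * α) * (a * γ - c * α) +
      c * (a * β - b * α) ^ 2 ≠ 0 := by
  intro hR
  set f := Polynomial.C a * Polynomial.X ^ 2 + Polynomial.C b * Polynomial.X + Polynomial.C c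
    with hfdef
  set g := Polynomial.C α * Polynomial.X ^ 2 + Polynomial.C β * Polynomial.X + Polynomial.C γ
    with hgdef
  set e := a * β - b * α with he
  set h := a * γ - c * α with hh
  have hdeg : f.natDegree = 2 := Polynomial.natDegree_quadratic ha
  have hsmall : ∀ u v : A, f ∣ Polynomial.C u * Polynomial.X + Polynomial.C v → u = 0 ∧ v = 0 := by
    intro u v huv
    have h0 : Polynomial.C u * Polynomial.X + Polynomial.C v = 0 := by
      apply Polynomial.eq_zero_of_dvd_of_natDegree_lt huv
      rw [hdeg]
      exact lt_of_le_of_lt Polynomial.natDegree_linear_le (by norm_num)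
    constructor
    · simpa using congrArg (fun p => Polynomial.coeff p 1) h0
    · simpa using congrArg (fun p => Polynomial.coeff p 0) h0
  have hw : Polynomial.C a * g - Polynomial.C α * f =
      Polynomial.C e * Polynomial.X + Polynomial.C h := by
    simp only [hfdef, hgdef, he, hh, Polynomial.C_sub, Polynomial.C_mul]
    ring
  have hprod : Polynomial.C (e ^ 2) * f = (Polynomial.C e * Polynomial.X + Polynomial.C h) *
      (Polynomial.C (a * e) * Polynomial.X + Polynomial.C (b * e - a * h)) := by
    have hR' := congrArg (Polynomial.C : A → Polynomial A) hR
    simp only [hfdef, Polynomial.C_sub, Polynomial.C_mul, Polynomial.C_add, Polynomial.C_pow,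
      Polynomial.C_0] at hR' ⊢
    linear_combination hR'
  have hzero : e = 0 ∧ h = 0 := by
    rcases hf.dvd_or_dvd (Dvd.intro_left _ hprod) with h1 | h1
    · exact hsmall _ _ h1
    · obtain ⟨h2, h3⟩ := hsmall _ _ h1
      have he0 : e = 0 := (mul_eq_zero.mp h2).resolve_left ha
      rw [he0] at h3
      refine ⟨he0, ?_⟩
      have : a * h = 0 := by linear_combination - h3
      exact (mul_eq_zero.mp this).resolve_left ha
  rw [hzero.1, hzero.2] at hw
  have hag : f ∣ Polynomial.C a * g := ⟨Polynomial.C α, by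
    simp only [Polynomial.C_0, zero_mul, add_zero] at hw
    linear_combination hw⟩
  rcases hf.dvd_or_dvd hag with h1 | h1
  · have := hsmall 0 a (by simpa using h1)
    exact ha this.2
  · exact hfg h1

/-- The substitution `D ↦ s v + D`. -/
noncomputable def shiftHom {K : Type*} [Field K] (v : Fin 4 → K) :
    MvPolynomial (Fin 4) K →+* Polynomial (MvPolynomial (Fin 4) K) :=
  eval₂Hom (Polynomial.C.comp C)
    (fun i => Polynomial.X * Polynomial.C (C (v i)) + 1 * Polynomial.C (X i))

/-- The substitution `D ↦ s v + D`, `s ↦ s`. -/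
noncomputable def shiftHom' {K : Type*} [Field K] (v : Fin 4 → K) :
    Polynomial (MvPolynomial (Fin 4) K) →+* Polynomial (MvPolynomial (Fin 4) K) :=
  Polynomial.eval₂RingHom (shiftHom v) Polynomial.X

lemma shiftHom'_comp {K : Type*} [Field K] (v w : Fin 4 → K) (h : ∀ i, v i + w i = 0) :
    (shiftHom' v).comp (shiftHom' w) = RingHom.id _ := by
  apply Polynomial.ringHom_ext'
  · apply MvPolynomial.ringHom_ext
    · intro r
      simp [shiftHom', shiftHom]
    · intro i
      have h1 : Polynomial.C (C (v i)) + Polynomial.C (C (w i)) =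
          (0 : Polynomial (MvPolynomial (Fin 4) K)) := by
        rw [← Polynomial.C_add, ← C_add, h i]; simp
      simp [shiftHom', shiftHom]
      linear_combination Polynomial.X * h1
  · simp [shiftHom']

noncomputable def shiftEquiv {K : Type*} [Field K] (v : Fin 4 → K) :
    Polynomial (MvPolynomial (Fin 4) K) ≃+* Polynomial (MvPolynomial (Fin 4) K) :=
  RingEquiv.ofRingHom (shiftHom' v) (shiftHom' (fun i => - v i))
    (shiftHom'_comp _ _ (by simp)) (shiftHom'_comp _ _ (by simp))

lemma shiftEquiv_C {K : Type*} [Field K] (v : Fin 4 → K) (G : MvPolynomial (Fin 4) K) :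
    shiftEquiv v (Polynomial.C G) = shiftHom v G := by
  simp [shiftEquiv, shiftHom']

lemma shiftHom_prime {K : Type*} [Field K] (v : Fin 4 → K) {F : MvPolynomial (Fin 4) K}
    (hF : Prime F) : Prime (shiftHom v F) := by
  rw [← shiftEquiv_C, MulEquiv.prime_iff (shiftEquiv v)]
  exact Polynomial.prime_C_iff.mpr hF

lemma shiftHom_dvd {K : Type*} [Field K] (v : Fin 4 → K) {F G : MvPolynomial (Fin 4) K}
    (h : shiftHom v F ∣ shiftHom v G) : F ∣ G := by
  rw [← shiftEquiv_C, ← shiftEquiv_C, map_dvd_iff] at h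
  have := (Polynomial.C_dvd_iff_dvd_coeff _ _).mp h 0
  simpa using this

lemma shift_eval₂_const {K : Type*} [Field K] (v : Fin 4 → K) (G : MvPolynomial (Fin 4) K) :
    eval₂ (Polynomial.C.comp (C : K →+* MvPolynomial (Fin 4) K))
      (fun i => Polynomial.C (C (v i))) G = Polynomial.C (C (eval v G)) := by
  have := eval₂_comp_left (Polynomial.C.comp (C : K →+* MvPolynomial (Fin 4) K))
    (RingHom.id K) v G
  rw [eval₂_id] at this
  exact this.symm

lemma shift_eval₂_X {K : Type*} [Field K] (G : MvPolynomial (Fin 4) K) :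
    eval₂ (Polynomial.C.comp (C : K →+* MvPolynomial (Fin 4) K))
      (fun i => Polynomial.C (X i)) G = Polynomial.C G := by
  have := eval₂_comp_left (Polynomial.C : MvPolynomial (Fin 4) K →+* _)
    (C : K →+* MvPolynomial (Fin 4) K) X G
  rw [eval₂_eta] at this
  exact this.symm

lemma shift_eval {K : Type*} [Field K] (v D : Fin 4 → K) (s : K) (G : MvPolynomial (Fin 4) K) :
    Polynomial.eval₂ (eval D) s (shiftHom v G) = eval (fun i => s * v i + D i) G := by
  have := eval₂_comp_left (Polynomial.eval₂RingHom (eval D) s)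
    (Polynomial.C.comp (C : K →+* MvPolynomial (Fin 4) K))
    (fun i => Polynomial.X * Polynomial.C (C (v i)) + 1 * Polynomial.C (X i)) G
  change Polynomial.eval₂RingHom (eval D) s (eval₂ _ _ G) = _
  rw [this, ← eval₂_id]
  congr 1
  · ext; simp
  · funext i; simp; exact mul_comm _ _

lemma shift_cubic {K : Type*} [Field K] (v : Fin 4 → K) {F : MvPolynomial (Fin 4) K}
    (hF : F.IsHomogeneous 3) (hv : eval v F = 0) :
    shiftHom v F = Polynomial.C (∑ j, X j * C (eval v (pderiv j F))) * Polynomial.X ^ 2 +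
      Polynomial.C (∑ j, C (v j) * pderiv j F) * Polynomial.X + Polynomial.C F := by
  have h := cubic_expand (Polynomial.C.comp (C : K →+* MvPolynomial (Fin 4) K)) hF
    (fun i => Polynomial.C (C (v i))) (fun i => Polynomial.C (X i)) Polynomial.X 1
  simp only [shift_eval₂_const, shift_eval₂_X, hv, ← Polynomial.C_mul, ← map_sum] at h
  change eval₂ _ _ F = _
  rw [h, C_0, Polynomial.C_0]
  ring

lemma shift_quad {K : Type*} [Field K] (v : Fin 4 → K) {Q : MvPolynomial (Fin 4) K}
    (hQ : Q.IsHomogeneous 2) :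
    shiftHom v Q = Polynomial.C (C (eval v Q)) * Polynomial.X ^ 2 +
      Polynomial.C (∑ j, X j * C (eval v (pderiv j Q))) * Polynomial.X + Polynomial.C Q := by
  have h := (quad_expand (Polynomial.C.comp (C : K →+* MvPolynomial (Fin 4) K)) hQ
    (fun i => Polynomial.C (C (v i))) (fun i => Polynomial.C (X i)) Polynomial.X 1).1
  simp only [shift_eval₂_const, shift_eval₂_X, ← Polynomial.C_mul, ← map_sum] at h
  change eval₂ _ _ Q = _
  rw [h]
  ring

lemma shift_lin {K : Type*} [Field K] (v : Fin 4 → K) {l : MvPolynomial (Fin 4) K}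
    (hl : l.IsHomogeneous 1) :
    shiftHom v l = Polynomial.C 0 * Polynomial.X ^ 2 +
      Polynomial.C (C (eval v l)) * Polynomial.X + Polynomial.C l := by
  have h := (lin_expand (Polynomial.C.comp (C : K →+* MvPolynomial (Fin 4) K)) hl
    (fun i => Polynomial.C (C (v i))) (fun i => Polynomial.C (X i)) Polynomial.X 1).1
  simp only [shift_eval₂_const, shift_eval₂_X] at h
  change eval₂ _ _ l = _
  rw [h, Polynomial.C_0]
  ring

lemma lin_hom {K : Type*} [Field K] (w : Fin 4 → K) :
    (∑ j, X j * C (w j) : MvPolynomial (Fin 4) K).IsHomogeneous 1 := by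
  refine IsHomogeneous.sum _ _ _ fun j _ => ?_
  simpa using (isHomogeneous_X K j).mul (isHomogeneous_C (Fin 4) (w j))

lemma polar_hom {K : Type*} [Field K] (w : Fin 4 → K) {F : MvPolynomial (Fin 4) K}
    (hF : F.IsHomogeneous 3) :
    (∑ j, C (w j) * pderiv j F : MvPolynomial (Fin 4) K).IsHomogeneous 2 := by
  refine IsHomogeneous.sum _ _ _ fun j _ => ?_
  simpa using (isHomogeneous_C (Fin 4) (w j)).mul (hF.pderiv (i := j))

lemma exists_res {K : Type*} [Field K] (v : Fin 4 → K) {F : MvPolynomial (Fin 4) K}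
    (hF0 : F ≠ 0) (hF : F.IsHomogeneous 3) (hirr : Irreducible F) (hv : eval v F = 0)
    (ha : (∑ j, X j * C (eval v (pderiv j F)) : MvPolynomial (Fin 4) K) ≠ 0)
    {G : MvPolynomial (Fin 4) K} (hG : G.IsHomogeneous 1 ∨ G.IsHomogeneous 2) (hG0 : G ≠ 0) :
    ∃ R : MvPolynomial (Fin 4) K, R ≠ 0 ∧ R.totalDegree ≤ 15 ∧ ∀ (D : Fin 4 → K) (s : K),
      eval (fun i => s * v i + D i) F = 0 → eval (fun i => s * v i + D i) G = 0 →
      eval D R = 0 := by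
  have hGd : G.totalDegree ≤ 2 := by
    rcases hG with h | h
    · exact h.totalDegree_le.trans (by norm_num)
    · exact h.totalDegree_le
  have hnd : ¬ F ∣ G := by
    rintro ⟨H, rfl⟩
    have hH0 : H ≠ 0 := by rintro rfl; simp at hG0
    rw [totalDegree_mul_of_isDomain hF0 hH0, hF.totalDegree hF0] at hGd
    omega
  obtain ⟨α, β, γ, hα, hβ, hγ, hq⟩ : ∃ α β γ : MvPolynomial (Fin 4) K, α.totalDegree ≤ 3 ∧
      β.totalDegree ≤ 3 ∧ γ.totalDegree ≤ 3 ∧ shiftHom v G =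
      Polynomial.C α * Polynomial.X ^ 2 + Polynomial.C β * Polynomial.X + Polynomial.C γ := by
    rcases hG with h | h
    · exact ⟨_, _, _, by simp, by simp, by omega, shift_lin v h⟩
    · exact ⟨_, _, _, by simp, (lin_hom _).totalDegree_le.trans (by norm_num), by omega,
        shift_quad v h⟩
  have hf := shift_cubic v hF hv
  set a := (∑ j, X j * C (eval v (pderiv j F)) : MvPolynomial (Fin 4) K) with hadef
  set b := (∑ j, C (v j) * pderiv j F : MvPolynomial (Fin 4) K) with hbdef
  have had : a.totalDegree ≤ 3 := (lin_hom _).totalDegree_le.trans (by norm_num)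
  have hbd : b.totalDegree ≤ 3 := (polar_hom v hF).totalDegree_le.trans (by norm_num)
  have hcd : F.totalDegree ≤ 3 := hF.totalDegree_le
  refine ⟨_, res_ne_zero a b F α β γ ha (hf ▸ shiftHom_prime v hirr.prime)
    (by rw [← hf, ← hq]; exact fun h => hnd (shiftHom_dvd v h)), ?_, ?_⟩
  · have hm : ∀ {p q : MvPolynomial (Fin 4) K} {m n : ℕ}, p.totalDegree ≤ m →
        q.totalDegree ≤ n → (p * q).totalDegree ≤ m + n := fun hp hq =>
      (totalDegree_mul _ _).trans (add_le_add hp hq)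
    have hsub : ∀ {p q : MvPolynomial (Fin 4) K} {m : ℕ}, p.totalDegree ≤ m →
        q.totalDegree ≤ m → (p - q).totalDegree ≤ m := fun hp hq =>
      (totalDegree_sub _ _).trans (max_le hp hq)
    have hadd : ∀ {p q : MvPolynomial (Fin 4) K} {m : ℕ}, p.totalDegree ≤ m →
        q.totalDegree ≤ m → (p + q).totalDegree ≤ m := fun hp hq =>
      (totalDegree_add _ _).trans (max_le hp hq)
    have he := hsub (hm had hβ) (hm hbd hα)
    have hh := hsub (hm had hγ) (hm hcd hα)
    rw [pow_two, pow_two, mul_assoc b]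
    exact hadd (hsub (hm had (hm hh hh)) (hm hbd (hm he hh))) (hm hcd (hm he he))
  · intro D s h1 h2
    rw [← shift_eval, hf] at h1
    rw [← shift_eval, hq] at h2
    simp only [Polynomial.eval₂_add, Polynomial.eval₂_mul, Polynomial.eval₂_C,
      Polynomial.eval₂_X, Polynomial.eval₂_pow] at h1 h2
    simp only [map_add, map_sub, map_mul, map_pow]
    generalize eval D a = a' at *
    generalize eval D b = b' at *
    generalize eval D F = c' at *
    generalize eval D α = α' at *
    generalize eval D β = β' at *
    generalize eval D γ = γ' at *
    linear_combination (a' * β' - b' * α') ^ 2 * h1 -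
      (a' * (a' * β' - b' * α') * s + b' * (a' * β' - b' * α') - a' * (a' * γ' - c' * α')) *
        (a' * h2 - α' * h1)

/-! ### The intermediate field and the conclusion -/

lemma exists_half_field {k K : Type} [Field k] [Fintype k] [Field K] [Algebra k K] [Finite K]
    (j : ℕ) (h : Module.finrank k K = 2 ^ (j + 1)) :
    ∃ L : IntermediateField k K, 2 ^ 2 ^ j ≤ Nat.card L ∧
      ∀ a b c : K, a ∈ L → b ∈ L → c ∈ L → a ≠ 0 → ∃ s : K, a * s ^ 2 + b * s + c = 0 := by
  obtain ⟨p, hp⟩ := CharP.exists k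
  have : Fact p.Prime := ⟨CharP.char_is_prime k p⟩
  have hE : Module.finrank k (FiniteField.Extension k p (2 ^ j)) = 2 ^ j :=
    FiniteField.finrank_extension k p (2 ^ j)
  obtain ⟨φ⟩ := FiniteField.nonempty_algHom_of_finrank_dvd (F := k)
    (K := FiniteField.Extension k p (2 ^ j)) (L := K) (by rw [hE, h]; exact pow_dvd_pow 2 (by omega))
  have hL : Module.finrank k φ.fieldRange = 2 ^ j :=
    (LinearEquiv.finrank_eq (AlgEquiv.ofInjectiveField φ).toLinearEquiv).symm.trans hE
  refine ⟨φ.fieldRange, ?_, ?_⟩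
  · rw [Module.natCard_eq_pow_finrank (K := k), hL]
    exact Nat.pow_le_pow_left Finite.one_lt_card _
  · intro a b c ha hb hc ha0
    have hLK : Module.finrank φ.fieldRange K = 2 := by
      have h1 := Module.finrank_mul_finrank k φ.fieldRange K
      rw [hL, h, pow_succ] at h1
      exact Nat.eq_of_mul_eq_mul_left (by positivity) h1
    let q : Polynomial φ.fieldRange := Polynomial.C ⟨a, ha⟩ * Polynomial.X ^ 2 +
      Polynomial.C ⟨b, hb⟩ * Polynomial.X + Polynomial.C ⟨c, hc⟩
    have hqd : q.natDegree = 2 := Polynomial.natDegree_quadratic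
      (by intro h; exact ha0 (congrArg Subtype.val h))
    have hq : ∀ s : K, Polynomial.aeval s q = a * s ^ 2 + b * s + c := by
      intro s
      simp only [q, map_add, map_mul, map_pow, Polynomial.aeval_X, Polynomial.aeval_C]
      rfl
    by_cases hirr : Irreducible q
    · have : Fact (Irreducible q) := ⟨hirr⟩
      have hfr : Module.finrank φ.fieldRange (AdjoinRoot q) = 2 := by
        rw [(AdjoinRoot.powerBasis hirr.ne_zero).finrank, AdjoinRoot.powerBasis_dim, hqd]
      obtain ⟨ψ⟩ := FiniteField.nonempty_algHom_of_finrank_dvd (F := φ.fieldRange)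
        (K := AdjoinRoot q) (L := K) (by rw [hfr, hLK])
      refine ⟨ψ (AdjoinRoot.root q), ?_⟩
      rw [← hq, Polynomial.aeval_algHom_apply, AdjoinRoot.aeval_eq, AdjoinRoot.mk_self, map_zero]
    · have hex : ∃ x, q.IsRoot x := by
        by_contra hcon
        push Not at hcon
        exact hirr (Polynomial.irreducible_of_degree_le_three_of_not_isRoot
          (by rw [hqd]; decide) hcon)
      obtain ⟨x, hx⟩ := hex
      refine ⟨(x : K), ?_⟩
      rw [← hq]
      have : Polynomial.aeval (algebraMap φ.fieldRange K x) q = 0 := by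
        rw [Polynomial.aeval_algebraMap_apply]
        have : Polynomial.aeval x q = 0 := hx
        rw [this, map_zero]
      exact this

lemma map_pderiv_eval {k K : Type*} [Field k] [Field K] (φ : k →+* K) (i : Fin 4)
    (F : MvPolynomial (Fin 4) k) : map φ (pderiv i F) = pderiv i (map φ F) :=
  (pderiv_map (f := F) (φ := φ) (i := i)).symm

lemma eval_map_comm {k K : Type*} [Field k] [Field K] (φ : k →+* K) (v : Fin 4 → k)
    (G : MvPolynomial (Fin 4) k) : eval (fun i => φ (v i)) (map φ G) = φ (eval v G) := by
  rw [eval_map]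
  have := eval₂_comp_left φ (RingHom.id k) v G
  rw [eval₂_id] at this
  exact this.symm

lemma eval_mem {k K : Type*} [Field k] [Field K] [Algebra k K] (L : IntermediateField k K)
    (G : MvPolynomial (Fin 4) k) (D : Fin 4 → K) (hD : ∀ i, D i ∈ L) :
    eval D (map (algebraMap k K) G) ∈ L := by
  have h := aeval_algebraMap_apply K (fun i => (⟨D i, hD i⟩ : L)) G
  rw [eval_map]
  have : aeval (algebraMap L K ∘ fun i => (⟨D i, hD i⟩ : L)) G ∈ L := by
    rw [h]; exact (aeval (fun i => (⟨D i, hD i⟩ : L)) G).2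
  exact this

/-- For a smooth cubic surface `V : F = 0` over a finite field `k` and any `n ≥ 1`,
there is a tower of `j` quadratic extensions `K/k` (i.e. `[K : k] = 2^j`) such that any
`n` points of `V(K)` admit a common point of `V(K)` in general position with all of them. -/
theorem stmt0 {k : Type} [Field k] [Fintype k]
    (F : MvPolynomial (Fin 4) k) (hF0 : F ≠ 0) (hF3 : F.IsHomogeneous 3)
    (hsm : IsSmoothCubicSurface F) (n : ℕ) (hn : 1 ≤ n) :
    ∃ j : ℕ, ∀ (K : Type) [Field K] [Algebra k K],
      Module.finrank k K = 2 ^ j →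
      ∀ P : Fin n → (Fin 4 → K),
        (∀ i, P i ≠ 0 ∧ MvPolynomial.eval (P i) (MvPolynomial.map (algebraMap k K) F) = 0) →
        ∃ P' : Fin 4 → K, P' ≠ 0 ∧
          MvPolynomial.eval P' (MvPolynomial.map (algebraMap k K) F) = 0 ∧
          ∀ i, InGeneralPosition (MvPolynomial.map (algebraMap k K) F) (P i) P' := by
  refine ⟨30 * n + 5, ?_⟩
  intro K _ _ hfin P hP
  have hFD : Module.Finite k K := Module.finite_of_finrank_pos (by rw [hfin]; positivity)
  have hKfin : Finite K := Module.finite_of_finite k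
  have : Fintype K := Fintype.ofFinite K
  -- smoothness over `K`
  let Ω := AlgebraicClosure k
  let τ : K →ₐ[k] Ω := IsAlgClosed.lift
  have hτ : ∀ G : MvPolynomial (Fin 4) k,
      map (τ : K →+* Ω) (map (algebraMap k K) G) = map (algebraMap k Ω) G := by
    intro G
    rw [map_map]
    congr 2
    exact τ.comp_algebraMap
  have hτe : ∀ (x : Fin 4 → K) (G : MvPolynomial (Fin 4) k),
      eval (fun i => τ (x i)) (map (algebraMap k Ω) G) =
        τ (eval x (map (algebraMap k K) G)) := by
    intro x G
    rw [← hτ]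
    exact eval_map_comm (τ : K →+* Ω) x _
  have hτ0 : ∀ x : Fin 4 → K, x ≠ 0 → (fun i => τ (x i)) ≠ 0 := by
    intro x hx h
    apply hx
    funext i
    have := congrFun h i
    simpa using this
  set FK := map (algebraMap k K) F with hFK
  have hFK3 : FK.IsHomogeneous 3 := hF3.map _
  have hFK0 : FK ≠ 0 := by
    intro h
    exact hF0 (map_injective _ (algebraMap k K).injective (by rw [← hFK, h, map_zero]))
  have hsK : ∀ x : Fin 4 → K, x ≠ 0 → eval x FK = 0 → (∀ i, eval x (pderiv i FK) = 0) →
      False := by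
    intro x hx h1 h2
    refine hsm _ (hτ0 x hx) ⟨?_, ?_⟩
    · rw [hτe, ← hFK, h1, map_zero]
    · intro i
      rw [hτe, map_pderiv_eval, ← hFK, h2, map_zero]
  have hirr : Irreducible FK := cubic_irreducible hFK0 hFK3 hsK
  -- linear polar forms are nonzero
  have hlin : ∀ x : Fin 4 → K, x ≠ 0 → eval x FK = 0 →
      (∑ j, X j * C (eval x (pderiv j FK)) : MvPolynomial (Fin 4) K) ≠ 0 := by
    intro x hx h1 h2
    refine hsK x hx h1 fun i => ?_
    have := congrArg (eval (Pi.single i 1)) h2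
    simpa [Pi.single_apply] using this
  -- quadratic polar forms are nonzero
  have hquad : ∀ x : Fin 4 → K, x ≠ 0 → eval x FK = 0 →
      (∑ j, C (x j) * pderiv j FK : MvPolynomial (Fin 4) K) ≠ 0 := by
    intro x hx h1 h2
    refine polar_ne_zero (F := map (algebraMap k Ω) F) (hF3.map _) ?_ (hτ0 x hx) ?_ ?_
    · intro y hy h3 h4
      refine hsm y hy ⟨h3, fun i => ?_⟩
      rw [map_pderiv_eval]
      exact h4 i
    · rw [hτe, ← hFK, h1, map_zero]
    · have := congrArg (map (τ : K →+* Ω)) h2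
      simp only [map_sum, map_mul, map_C, map_zero] at this
      rw [← this]
      refine Finset.sum_congr rfl fun j _ => ?_
      rw [map_pderiv_eval, hFK, hτ]
      rfl
  -- a rational point over `k`
  obtain ⟨v, hv0, hv, -⟩ := exists_common_zero (G := F) (H := 0)
    (by simp only [totalDegree_zero]; have := hF3.totalDegree_le; omega)
    (hom_eval_zero hF3 (by norm_num)) (by simp)
  let w : Fin 4 → K := fun i => algebraMap k K (v i)
  have hw0 : w ≠ 0 := by
    intro h
    apply hv0
    funext i
    have := congrFun h i
    simpa [w] using this
  have hw : eval w FK = 0 := by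
    rw [hFK, eval_map_comm, hv, map_zero]
  have ha := hlin w hw0 hw
  -- the eliminants
  have hR1 := fun i => exists_res w hFK0 hFK3 hirr hw ha (Or.inl (lin_hom _))
    (hlin (P i) (hP i).1 (hP i).2)
  have hR2 := fun i => exists_res w hFK0 hFK3 hirr hw ha (Or.inr (polar_hom _ hFK3))
    (hquad (P i) (hP i).1 (hP i).2)
  choose R1 h1n h1d h1e using hR1
  choose R2 h2n h2d h2e using hR2
  let T : MvPolynomial (Fin 4) K :=
    (∑ j, X j * C (eval w (pderiv j FK))) * ∏ i, (R1 i * R2 i)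
  have hT0 : T ≠ 0 := mul_ne_zero ha
    (Finset.prod_ne_zero_iff.mpr fun i _ => mul_ne_zero (h1n i) (h2n i))
  have hTd : T.totalDegree ≤ 30 * n + 1 := by
    refine (totalDegree_mul _ _).trans ?_
    have e1 := (lin_hom (fun j => eval w (pderiv j FK))).totalDegree_le
    have e2 : (∏ i, (R1 i * R2 i)).totalDegree ≤ ∑ _i : Fin n, 30 := by
      refine (totalDegree_finsetProd _ _).trans (Finset.sum_le_sum fun i _ => ?_)
      have := h1d i
      have := h2d i
      exact (totalDegree_mul _ _).trans (by omega)
    simp only [Finset.sum_const, Finset.card_univ, Fintype.card_fin, smul_eq_mul] at e2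
    omega
  obtain ⟨L, hLc, hLq⟩ := exists_half_field (30 * n + 4) hfin
  -- choose a direction over the half field
  obtain ⟨D, hDL, hDT⟩ : ∃ D : Fin 4 → K, (∀ i, D i ∈ L) ∧ eval D T ≠ 0 := by
    by_contra hcon
    push Not at hcon
    let S : Finset K := (Set.toFinite (L : Set K)).toFinset
    refine hT0 (eq_zero_of_eval_zero_at_prod_finset T (fun _ => S) ?_ ?_)
    · intro i
      have hS : S.card = Nat.card L := by
        rw [← Set.ncard_eq_toFinset_card (L : Set K), ← Nat.card_coe_set_eq]
        rfl
      rw [hS]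
      have e1 := degreeOf_le_totalDegree T i
      have e2 : 30 * n + 4 < 2 ^ (30 * n + 4) := Nat.lt_two_pow_self
      have e3 : 2 ^ (30 * n + 4) < 2 ^ 2 ^ (30 * n + 4) := Nat.lt_two_pow_self
      omega
    · intro x hx
      exact hcon x fun i => by simpa [S] using hx i
  have hDT' : eval D (∑ j, X j * C (eval w (pderiv j FK))) ≠ 0 ∧
      ∀ i, eval D (R1 i) ≠ 0 ∧ eval D (R2 i) ≠ 0 := by
    simp only [T, map_mul, map_prod] at hDT
    refine ⟨left_ne_zero_of_mul hDT, fun i => ?_⟩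
    have := Finset.prod_ne_zero_iff.mp (right_ne_zero_of_mul hDT) i (Finset.mem_univ i)
    exact ⟨left_ne_zero_of_mul this, right_ne_zero_of_mul this⟩
  have hwL : ∀ i, w i ∈ L := fun i => L.algebraMap_mem _
  have hpd : ∀ (x : Fin 4 → K) (i : Fin 4), (∀ i, x i ∈ L) → eval x (pderiv i FK) ∈ L := by
    intro x i hx
    rw [hFK, ← map_pderiv_eval]
    exact eval_mem L _ x hx
  obtain ⟨s, hs⟩ := hLq (eval D (∑ j, X j * C (eval w (pderiv j FK))))
    (eval D (∑ j, C (w j) * pderiv j FK)) (eval D FK)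
    (by
      simp only [map_sum, map_mul, eval_X, eval_C]
      exact sum_mem fun j _ => mul_mem (hDL j) (hpd w j hwL))
    (by
      simp only [map_sum, map_mul, eval_C]
      exact sum_mem fun j _ => mul_mem (hwL j) (hpd D j hDL))
    (eval_mem L F D hDL) hDT'.1
  have hX : eval (fun i => s * w i + D i) FK = 0 := by
    rw [← shift_eval, shift_cubic w hFK3 hw]
    simpa only [Polynomial.eval₂_add, Polynomial.eval₂_mul, Polynomial.eval₂_C,
      Polynomial.eval₂_X, Polynomial.eval₂_pow] using hs
  have hgp : ∀ i, InGeneralPosition FK (P i) (fun i => s * w i + D i) := by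
    intro i
    rw [inGeneralPosition_iff hFK3]
    constructor
    · intro h
      refine (hDT'.2 i).1 (h1e i D s hX ?_)
      simpa only [map_sum, map_mul, eval_X, eval_C] using h
    · intro h
      refine (hDT'.2 i).2 (h2e i D s hX ?_)
      simpa only [map_sum, map_mul, eval_C] using h
  refine ⟨fun i => s * w i + D i, ?_, hX, hgp⟩
  intro h0
  have := ((inGeneralPosition_iff hFK3 _ _).mp (hgp ⟨0, hn⟩)).1
  apply this
  refine Finset.sum_eq_zero fun j _ => ?_
  rw [show s * w j + D j = 0 from congrFun h0 j, zero_mul]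
end

section
/- Let 𝔽_Q be a finite field with Q elements, let F be a homogeneous cubic form in the 4 variables T₀,T₁,T₂,T₃ over 𝔽_Q defining a smooth cubic surface V, and let P be a point of V over 𝔽_Q. Then the number of projective points P′ of V over 𝔽_Q (i.e., nonzero zeros of F in 𝔽_Q⁴ counted up to scalar) that are NOT in general position with P is at most 9Q + 56√Q + 9. -/
open MvPolynomial

section CubicCore

/-- Explicit smoothness of `t²x + t q(x,y,z) + c(x,y,z)`. -/
def ExplSmooth {K : Type*} [Field K] (a : Fin 6 → K) (b : Fin 10 → K) : Prop :=
  ∀ t x y z : K, (t ≠ 0 ∨ x ≠ 0 ∨ y ≠ 0 ∨ z ≠ 0) →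
    t ^ 2 * x + t * (a 0 * x ^ 2 + a 1 * x * y + a 2 * x * z + a 3 * y ^ 2 + a 4 * y * z + a 5 * z ^ 2)
      + (b 0 * x ^ 3 + b 1 * x ^ 2 * y + b 2 * x ^ 2 * z + b 3 * x * y ^ 2 + b 4 * x * y * z
        + b 5 * x * z ^ 2 + b 6 * y ^ 3 + b 7 * y ^ 2 * z + b 8 * y * z ^ 2 + b 9 * z ^ 3) = 0 →
    2 * t * x + (a 0 * x ^ 2 + a 1 * x * y + a 2 * x * z + a 3 * y ^ 2 + a 4 * y * z + a 5 * z ^ 2) = 0 →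
    t ^ 2 + t * (2 * a 0 * x + a 1 * y + a 2 * z)
      + (3 * b 0 * x ^ 2 + 2 * b 1 * x * y + 2 * b 2 * x * z + b 3 * y ^ 2 + b 4 * y * z + b 5 * z ^ 2) = 0 →
    t * (a 1 * x + 2 * a 3 * y + a 4 * z)
      + (b 1 * x ^ 2 + 2 * b 3 * x * y + b 4 * x * z + 3 * b 6 * y ^ 2 + 2 * b 7 * y * z + b 8 * z ^ 2) = 0 →
    t * (a 2 * x + a 4 * y + 2 * a 5 * z)
      + (b 2 * x ^ 2 + b 4 * x * y + 2 * b 5 * x * z + b 7 * y ^ 2 + 2 * b 8 * y * z + 3 * b 9 * z ^ 2) = 0 →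
    False

lemma exists_quad {K : Type*} [Field K] [IsAlgClosed K] (p q : K) : ∃ t : K, t ^ 2 + t * p + q = 0 := by
  obtain ⟨t, ht⟩ := IsAlgClosed.exists_root (Polynomial.X ^ 2 + Polynomial.C p * Polynomial.X + Polynomial.C q) (by
    have : (Polynomial.X ^ 2 + Polynomial.C p * Polynomial.X + Polynomial.C q : Polynomial K).degree = 2 := by
      compute_degree!
    rw [this]; decide)
  refine ⟨t, ?_⟩
  simp [Polynomial.IsRoot] at ht
  linear_combination ht

lemma coreA {K : Type*} [Field K] [IsAlgClosed K] (a : Fin 6 → K) (b : Fin 10 → K)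
    (hs : ExplSmooth a b) (h3 : a 3 = 0) (h4 : a 4 = 0) (h6 : b 6 = 0) (h7 : b 7 = 0) : False := by
  obtain ⟨t, ht⟩ := exists_quad (a 1) (b 3)
  apply hs t 0 1 0 (by simp)
  · simp [h3, h6]
  · simp [h3]
  · linear_combination ht
  · simp [h3, h6]
  · simp [h4, h7]

/-- a pair of quadrics `X² = A + BX + CY`, `Y² = A' + B'X + C'Y` meets. -/
lemma exists_pair {K : Type*} [Field K] [IsAlgClosed K] (A B C A' B' C' : K) :
    ∃ X Y : K, X ^ 2 = A + B * X + C * Y ∧ Y ^ 2 = A' + B' * X + C' * Y := by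
  by_cases hC : C = 0
  · obtain ⟨X, hX⟩ := exists_quad (-B) (-A)
    obtain ⟨Y, hY⟩ := exists_quad (-C') (-A' - B' * X)
    exact ⟨X, Y, by rw [hC]; linear_combination hX, by linear_combination hY⟩
  · obtain ⟨X, hX⟩ := IsAlgClosed.exists_root
      (Polynomial.X ^ 4 + (Polynomial.C (-2 * B) * Polynomial.X ^ 3
        + Polynomial.C (B ^ 2 - 2 * A - C' * C) * Polynomial.X ^ 2
        + Polynomial.C (2 * A * B - B' * C ^ 2 + C' * C * B) * Polynomial.X
        + Polynomial.C (A ^ 2 - A' * C ^ 2 + C' * C * A))) (by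
      have : (Polynomial.X ^ 4 + (Polynomial.C (-2 * B) * Polynomial.X ^ 3
        + Polynomial.C (B ^ 2 - 2 * A - C' * C) * Polynomial.X ^ 2
        + Polynomial.C (2 * A * B - B' * C ^ 2 + C' * C * B) * Polynomial.X
        + Polynomial.C (A ^ 2 - A' * C ^ 2 + C' * C * A)) : Polynomial K).degree = 4 := by
        compute_degree!
      rw [this]; decide)
    simp only [Polynomial.IsRoot, Polynomial.eval_add, Polynomial.eval_mul, Polynomial.eval_pow,
      Polynomial.eval_X, Polynomial.eval_C] at hX
    refine ⟨X, (X ^ 2 - A - B * X) / C, by field_simp; ring, ?_⟩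
    field_simp
    linear_combination hX

lemma coreB {K : Type*} [Field K] [IsAlgClosed K] (a : Fin 6 → K) (b : Fin 10 → K)
    (hs : ExplSmooth a b) (h2 : (2 : K) = 0) (ha : ∀ i, a i = 0) : False := by
  -- it is enough to find a common zero of two of the partials
  have key : ∀ x y z : K, (x ≠ 0 ∨ y ≠ 0 ∨ z ≠ 0) →
      b 1 * x ^ 2 + b 4 * x * z + b 6 * y ^ 2 + b 8 * z ^ 2 = 0 →
      b 2 * x ^ 2 + b 4 * x * y + b 7 * y ^ 2 + b 9 * z ^ 2 = 0 → False := by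
    intro x y z h0 e1 e2
    obtain ⟨t, ht⟩ := exists_quad 0
      (3 * b 0 * x ^ 2 + 2 * b 1 * x * y + 2 * b 2 * x * z + b 3 * y ^ 2 + b 4 * y * z + b 5 * z ^ 2)
    have e0 : t ^ 2 + (3 * b 0 * x ^ 2 + 2 * b 1 * x * y + 2 * b 2 * x * z + b 3 * y ^ 2 + b 4 * y * z + b 5 * z ^ 2) = 0 := by
      linear_combination ht
    apply hs t x y z (by tauto)
    · simp only [ha]
      linear_combination x * e0 + y * e1 + z * e2
        - (b 0 * x ^ 3 + b 1 * x ^ 2 * y + b 2 * x ^ 2 * z + b 4 * x * y * z) * h2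
    · simp only [ha]
      linear_combination t * x * h2
    · simp only [ha]
      linear_combination e0
    · simp only [ha]
      linear_combination e1 + (b 3 * x * y + b 6 * y ^ 2 + b 7 * y * z) * h2
    · simp only [ha]
      linear_combination e2 + (b 5 * x * z + b 8 * y * z + b 9 * z ^ 2) * h2
  have hsq : ∀ u : K, ∃ v, v ^ 2 = u := fun u => by
    obtain ⟨v, hv⟩ := exists_quad 0 (-u)
    exact ⟨v, by linear_combination hv⟩
  by_cases hd : b 6 * b 9 - b 7 * b 8 = 0
  · by_cases h1 : b 6 = 0 ∧ b 8 = 0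
    · obtain ⟨y, hy⟩ := hsq (b 9)
      obtain ⟨z, hz⟩ := hsq (-b 7)
      by_cases h3 : b 9 = 0 ∧ b 7 = 0
      · exact key 0 1 0 (by simp) (by simp [h1]) (by simp [h3])
      · refine key 0 y z ?_ (by simp [h1]) ?_
        · by_contra h
          push Not at h
          apply h3
          rw [h.2.1] at hy
          rw [h.2.2] at hz
          exact ⟨by linear_combination -hy, by linear_combination hz⟩
        · rw [hy, hz]; ring
    · obtain ⟨y, hy⟩ := hsq (b 8)
      obtain ⟨z, hz⟩ := hsq (-b 6)
      refine key 0 y z ?_ (by rw [hy, hz]; ring) ?_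
      · by_contra h
        push Not at h
        apply h1
        rw [h.2.1] at hy
        rw [h.2.2] at hz
        exact ⟨by linear_combination hz, by linear_combination -hy⟩
      · rw [hy, hz]; linear_combination -hd
  · set d := b 6 * b 9 - b 7 * b 8 with hdd
    -- b6 y² + b8 z² = -(b1 + b4 z),  b7 y² + b9 z² = -(b2 + b4 y)
    obtain ⟨y, z, hy, hz⟩ := exists_pair
      ((b 8 * b 2 - b 9 * b 1) / d) (b 8 * b 4 / d) (-b 9 * b 4 / d)
      ((b 7 * b 1 - b 6 * b 2) / d) (-b 6 * b 4 / d) (b 7 * b 4 / d)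
    refine key 1 y z (by simp) ?_ ?_
    · rw [hy, hz]; field_simp; rw [hdd]; ring
    · rw [hy, hz]; field_simp; rw [hdd]; ring

end CubicCore

section CubicCount

/-- Schwartz–Zippel count over a finite field. -/
lemma sz_count {k : Type*} [Field k] [Fintype k] [DecidableEq k] {m d : ℕ} (p : MvPolynomial (Fin (m + 1)) k)
    (hp : p ≠ 0) (hd : p.totalDegree ≤ d) :
    (Finset.univ.filter fun f : Fin (m + 1) → k => eval f p = 0).card ≤ d * Fintype.card k ^ m := by
  have h := schwartz_zippel_totalDegree hp (Finset.univ : Finset k)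
  rw [Fintype.piFinset_univ, Finset.card_univ] at h
  have hQ : (0 : ℚ≥0) < Fintype.card k := by exact_mod_cast Fintype.card_pos
  rw [div_le_div_iff₀ (by positivity) hQ, pow_succ] at h
  have h' : ((Finset.univ.filter fun f : Fin (m + 1) → k => eval f p = 0).card : ℚ≥0)
      ≤ p.totalDegree * (Fintype.card k : ℚ≥0) ^ m := by
    rw [← mul_assoc] at h
    exact le_of_mul_le_mul_right h hQ
  have h'' : (Finset.univ.filter fun f : Fin (m + 1) → k => eval f p = 0).card
      ≤ p.totalDegree * Fintype.card k ^ m := by exact_mod_cast h'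
  exact h''.trans (Nat.mul_le_mul_right _ hd)

/-- quadratic part -/
noncomputable def qPol {k : Type*} [Field k] (a : Fin 6 → k) : MvPolynomial (Fin 3) k :=
  C (a 0) * X 0 ^ 2 + C (a 1) * X 0 * X 1 + C (a 2) * X 0 * X 2 + C (a 3) * X 1 ^ 2
    + C (a 4) * X 1 * X 2 + C (a 5) * X 2 ^ 2

/-- cubic part -/
noncomputable def cPol {k : Type*} [Field k] (b : Fin 10 → k) : MvPolynomial (Fin 3) k :=
  C (b 0) * X 0 ^ 3 + C (b 1) * X 0 ^ 2 * X 1 + C (b 2) * X 0 ^ 2 * X 2 + C (b 3) * X 0 * X 1 ^ 2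
    + C (b 4) * X 0 * X 1 * X 2 + C (b 5) * X 0 * X 2 ^ 2 + C (b 6) * X 1 ^ 3
    + C (b 7) * X 1 ^ 2 * X 2 + C (b 8) * X 1 * X 2 ^ 2 + C (b 9) * X 2 ^ 3

/-- discriminant -/
noncomputable def dPol {k : Type*} [Field k] (a : Fin 6 → k) (b : Fin 10 → k) :
    MvPolynomial (Fin 3) k := qPol a ^ 2 - C 4 * X 0 * cPol b

/-- quadratic part on the line -/
noncomputable def qPol0 {k : Type*} [Field k] (a : Fin 6 → k) : MvPolynomial (Fin 2) k :=
  C (a 3) * X 0 ^ 2 + C (a 4) * X 0 * X 1 + C (a 5) * X 1 ^ 2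

/-- cubic part on the line -/
noncomputable def cPol0 {k : Type*} [Field k] (b : Fin 10 → k) : MvPolynomial (Fin 2) k :=
  C (b 6) * X 0 ^ 3 + C (b 7) * X 0 ^ 2 * X 1 + C (b 8) * X 0 * X 1 ^ 2 + C (b 9) * X 1 ^ 3

lemma hom2 {k σ : Type*} [Field k] (a : k) (i j : σ) :
    (C a * X i * X j : MvPolynomial σ k).IsHomogeneous 2 :=
  ((isHomogeneous_C _ a).mul (isHomogeneous_X _ i)).mul (isHomogeneous_X _ j)

lemma hom2' {k σ : Type*} [Field k] (a : k) (i : σ) :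
    (C a * X i ^ 2 : MvPolynomial σ k).IsHomogeneous 2 :=
  ((isHomogeneous_C _ a).mul ((isHomogeneous_X _ i).pow 2))

lemma hom3a {k σ : Type*} [Field k] (a : k) (i : σ) :
    (C a * X i ^ 3 : MvPolynomial σ k).IsHomogeneous 3 :=
  ((isHomogeneous_C _ a).mul ((isHomogeneous_X _ i).pow 3))

lemma hom3b {k σ : Type*} [Field k] (a : k) (i j : σ) :
    (C a * X i ^ 2 * X j : MvPolynomial σ k).IsHomogeneous 3 :=
  (hom2' a i).mul (isHomogeneous_X _ j)

lemma hom3c {k σ : Type*} [Field k] (a : k) (i j : σ) :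
    (C a * X i * X j ^ 2 : MvPolynomial σ k).IsHomogeneous 3 := by
  convert hom3b a j i using 1
  ring

lemma hom3d {k σ : Type*} [Field k] (a : k) (i j l : σ) :
    (C a * X i * X j * X l : MvPolynomial σ k).IsHomogeneous 3 :=
  (hom2 a i j).mul (isHomogeneous_X _ l)

lemma dPol_deg {k : Type*} [Field k] (a : Fin 6 → k) (b : Fin 10 → k) :
    (dPol a b).totalDegree ≤ 4 := by
  have hq : (qPol a).IsHomogeneous 2 :=
    (((((hom2' _ _).add (hom2 _ _ _)).add (hom2 _ _ _)).add (hom2' _ _)).add (hom2 _ _ _)).add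
      (hom2' _ _)
  have hc : (cPol b).IsHomogeneous 3 :=
    (((((((((hom3a _ _).add (hom3b _ _ _)).add (hom3b _ _ _)).add (hom3c _ _ _)).add
      (hom3d _ _ _ _)).add (hom3c _ _ _)).add (hom3a _ _)).add (hom3b _ _ _)).add
      (hom3c _ _ _)).add (hom3a _ _)
  have h : (dPol a b).IsHomogeneous 4 :=
    (hq.pow 2).sub (((isHomogeneous_C _ _).mul (isHomogeneous_X _ _)).mul hc)
  exact h.totalDegree_le

lemma qPol0_deg {k : Type*} [Field k] (a : Fin 6 → k) : (qPol0 a).totalDegree ≤ 3 := by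
  have hq : (qPol0 a).IsHomogeneous 2 := ((hom2' _ _).add (hom2 _ _ _)).add (hom2' _ _)
  exact hq.totalDegree_le.trans (by norm_num)

lemma cPol0_deg {k : Type*} [Field k] (b : Fin 10 → k) : (cPol0 b).totalDegree ≤ 3 := by
  have hq : (cPol0 b).IsHomogeneous 3 :=
    (((hom3a _ _).add (hom3b _ _ _)).add (hom3c _ _ _)).add (hom3a _ _)
  exact hq.totalDegree_le

lemma line_ne {k K : Type*} [Field k] [Field K] [IsAlgClosed K] [Algebra k K]
    (a : Fin 6 → k) (b : Fin 10 → k)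
    (hs : ExplSmooth (fun i => algebraMap k K (a i)) (fun i => algebraMap k K (b i))) :
    qPol0 a ≠ 0 ∨ cPol0 b ≠ 0 := by
  by_contra h
  push Not at h
  obtain ⟨h1, h2⟩ := h
  have a3 := congrArg (eval ![1, 0]) h1
  have a4 := congrArg (fun p => eval ![1, 0] (pderiv 1 p)) h1
  have b6 := congrArg (eval ![1, 0]) h2
  have b7 := congrArg (fun p => eval ![1, 0] (pderiv 1 p)) h2
  simp [qPol0, cPol0, pderiv_X] at a3 a4 b6 b7
  exact coreA _ _ hs (by simp [a3]) (by simp [a4]) (by simp [b6]) (by simp [b7])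

lemma dPol_ne {k K : Type*} [Field k] [Field K] [IsAlgClosed K] [Algebra k K]
    (a : Fin 6 → k) (b : Fin 10 → k)
    (hs : ExplSmooth (fun i => algebraMap k K (a i)) (fun i => algebraMap k K (b i))) :
    dPol a b ≠ 0 := by
  intro h
  have e (x y z : k) := congrArg (eval ![x, y, z]) h
  have f1 := congrArg (fun p => eval ![0, 1, 0] (pderiv 0 p)) h
  have f2 := congrArg (fun p => eval ![0, 1, 0] (pderiv 2 (pderiv 0 p))) h
  simp [dPol, qPol, cPol, pderiv_X] at e f1 f2
  have a3 : a 3 = 0 := by simpa using e 0 1 0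
  have a5 : a 5 = 0 := by simpa using e 0 0 1
  have a4 : a 4 = 0 := by simpa [a3, a5] using e 0 1 1
  by_cases h2 : (2 : k) = 0
  · have h4 : (4 : k) = 0 := by linear_combination 2 * h2
    have a0 : a 0 = 0 := by simpa [h4] using e 1 0 0
    have a1 : a 1 = 0 := by simpa [h4, a0, a3] using e 1 1 0
    have a2 : a 2 = 0 := by simpa [h4, a0, a5] using e 1 0 1
    refine coreB _ _ hs ?_ ?_
    · have := congrArg (algebraMap k K) h2
      rwa [map_ofNat, map_zero] at this
    · intro i
      fin_cases i <;> simp [*]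
  · have h4 : (4 : k) ≠ 0 := by
      intro h4
      apply h2
      have : (2 : k) ^ 2 = 0 := by linear_combination h4
      simpa using this
    have b6 : b 6 = 0 := by simpa [a3, h4] using f1
    have b7 : b 7 = 0 := by simpa [a3, a4, h4] using f2
    exact coreA _ _ hs (by simp [a3]) (by simp [a4]) (by simp [b6]) (by simp [b7])

/-- The set of "bad" vectors. -/
def Bad {k : Type*} [Field k] (a : Fin 6 → k) (b : Fin 10 → k) (v : Fin 4 → k) : Prop :=
  v 0 ^ 2 * v 1 + v 0 * eval ![v 1, v 2, v 3] (qPol a) + eval ![v 1, v 2, v 3] (cPol b) = 0 ∧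
  (v 1 = 0 ∨ 2 * v 0 * v 1 + eval ![v 1, v 2, v 3] (qPol a) = 0)

lemma bad_count {k K : Type*} [Field k] [Fintype k] [Field K] [IsAlgClosed K] [Algebra k K]
    (a : Fin 6 → k) (b : Fin 10 → k)
    (hs : ExplSmooth (fun i => algebraMap k K (a i)) (fun i => algebraMap k K (b i))) :
    Nat.card {v : Fin 4 → k // Bad a b v} ≤ 8 * Fintype.card k ^ 2 := by
  classical
  rw [Nat.card_eq_fintype_card, Fintype.card_subtype]
  set Q := Fintype.card k with hQ
  obtain ⟨h, hne, hdeg, hh⟩ : ∃ h : MvPolynomial (Fin 2) k, h ≠ 0 ∧ h.totalDegree ≤ 3 ∧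
      ∀ w, eval w (qPol0 a) = 0 → eval w (cPol0 b) = 0 → eval w h = 0 := by
    rcases line_ne a b hs with h | h
    · exact ⟨_, h, qPol0_deg a, fun w h _ => h⟩
    · exact ⟨_, h, cPol0_deg b, fun w _ h => h⟩
  have q0 : ∀ y z, eval ![0, y, z] (qPol a) = eval ![y, z] (qPol0 a) := by
    intro y z; simp [qPol, qPol0]
  have c0 : ∀ y z, eval ![0, y, z] (cPol b) = eval ![y, z] (cPol0 b) := by
    intro y z; simp [cPol, cPol0]
  have vext : ∀ v w : Fin 4 → k, v 0 = w 0 → v 1 = w 1 → v 2 = w 2 → v 3 = w 3 → v = w := by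
    intro v w h0 h1 h2 h3
    funext i
    fin_cases i <;> assumption
  let B1 := Finset.univ.filter fun v : Fin 4 → k => Bad a b v ∧ v 1 ≠ 0
  let B2 := Finset.univ.filter fun v : Fin 4 → k => Bad a b v ∧ v 1 = 0 ∧ eval ![v 2, v 3] (qPol0 a) ≠ 0
  let B3 := Finset.univ.filter fun v : Fin 4 → k => Bad a b v ∧ v 1 = 0 ∧ eval ![v 2, v 3] (qPol0 a) = 0
  have hsub : (Finset.univ.filter fun v : Fin 4 → k => Bad a b v) ⊆ B1 ∪ (B2 ∪ B3) := by
    intro v hv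
    simp only [B1, B2, B3, Finset.mem_union, Finset.mem_filter, Finset.mem_univ, true_and] at hv ⊢
    tauto
  have h1 : B1.card ≤ 4 * Q ^ 2 := by
    refine le_trans ?_ (sz_count (dPol a b) (dPol_ne a b hs) (dPol_deg a b))
    refine Finset.card_le_card_of_injOn (fun v => ![v 1, v 2, v 3]) ?_ ?_
    · intro v hv
      simp only [B1, Finset.coe_filter, Finset.mem_univ, true_and, Set.mem_ofPred_eq] at hv ⊢
      obtain ⟨⟨e1, e2⟩, h1⟩ := hv
      replace e2 := e2.resolve_left h1
      simp only [dPol, map_sub, map_pow, map_mul, eval_C, eval_X, Matrix.cons_val_zero]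
      linear_combination (-4 * v 1) * e1 + (2 * v 0 * v 1 + eval ![v 1, v 2, v 3] (qPol a)) * e2
    · intro v hv w hw hvw
      simp only [B1, Finset.coe_filter, Finset.mem_univ, true_and, Set.mem_ofPred_eq] at hv hw
      obtain ⟨⟨e1, e2⟩, h1⟩ := hv
      obtain ⟨⟨e1', -⟩, -⟩ := hw
      replace e2 := e2.resolve_left h1
      simp only at hvw
      have k1 : v 1 = w 1 := congrFun hvw 0
      have k2 : v 2 = w 2 := congrFun hvw 1
      have k3 : v 3 = w 3 := congrFun hvw 2
      rw [← hvw, ← k1] at e1'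
      have : v 1 * (w 0 - v 0) ^ 2 = 0 := by
        linear_combination e1' - e1 - (w 0 - v 0) * e2
      have h0 : w 0 - v 0 = 0 := by simpa [h1] using this
      exact vext v w (by linear_combination -h0) k1 k2 k3
  have h2 : B2.card ≤ Q ^ 2 := by
    have : (Finset.univ : Finset (Fin 2 → k)).card = Q ^ 2 := by simp [hQ]
    rw [← this]
    refine Finset.card_le_card_of_injOn (fun v => ![v 2, v 3]) (by simp [Set.MapsTo]) ?_
    intro v hv w hw hvw
    simp only [B2, Finset.coe_filter, Finset.mem_univ, true_and, Set.mem_ofPred_eq] at hv hw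
    obtain ⟨⟨e1, -⟩, h1, hq⟩ := hv
    obtain ⟨⟨e1', -⟩, h1', hq'⟩ := hw
    rw [h1, q0, c0] at e1
    rw [h1', q0, c0] at e1'
    simp only at hvw
    rw [← hvw] at e1'
    have k2 : v 2 = w 2 := congrFun hvw 0
    have k3 : v 3 = w 3 := congrFun hvw 1
    have : (w 0 - v 0) * eval ![v 2, v 3] (qPol0 a) = 0 := by linear_combination e1' - e1
    have h0 : w 0 - v 0 = 0 := by simpa [hq] using this
    exact vext v w (by linear_combination -h0) (by rw [h1, h1']) k2 k3
  have h3 : B3.card ≤ 3 * Q ^ 2 := by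
    have hc : ((Finset.univ : Finset k) ×ˢ
        (Finset.univ.filter fun f : Fin 2 → k => eval f h = 0)).card ≤ 3 * Q ^ 2 := by
      rw [Finset.card_product, Finset.card_univ, ← hQ]
      calc _ ≤ Q * (3 * Q ^ 1) := Nat.mul_le_mul_left _ (sz_count h hne hdeg)
        _ = _ := by ring
    refine le_trans ?_ hc
    refine Finset.card_le_card_of_injOn (fun v => (v 0, ![v 2, v 3])) ?_ ?_
    · intro v hv
      simp only [B3, Finset.coe_filter, Finset.mem_univ, true_and, Set.mem_ofPred_eq] at hv
      obtain ⟨⟨e1, -⟩, h1, hq⟩ := hv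
      rw [h1, q0, c0, hq] at e1
      simp only [Finset.coe_product, Finset.coe_univ, Set.mem_prod, Set.mem_univ, true_and,
        Finset.coe_filter, Finset.mem_univ, Set.mem_ofPred_eq]
      exact hh _ hq (by linear_combination e1)
    · intro v hv w hw hvw
      simp only [B3, Finset.coe_filter, Finset.mem_univ, true_and, Set.mem_ofPred_eq] at hv hw
      simp only [Prod.mk.injEq] at hvw
      exact vext v w hvw.1 (by rw [hv.2.1, hw.2.1]) (congrFun hvw.2 0) (congrFun hvw.2 1)
  calc _ ≤ (B1 ∪ (B2 ∪ B3)).card := Finset.card_le_card hsub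
    _ ≤ B1.card + (B2 ∪ B3).card := Finset.card_union_le _ _
    _ ≤ B1.card + (B2.card + B3.card) := Nat.add_le_add_left (Finset.card_union_le _ _) _
    _ ≤ 8 * Q ^ 2 := by omega

end CubicCount

section CubicTransfer

lemma finsupp_split {σ : Type*} (m : σ →₀ ℕ) (n : ℕ) (h : m.degree = n + 1) :
    ∃ i m', m = Finsupp.single i 1 + m' ∧ m'.degree = n := by
  classical
  have h0 : m ≠ 0 := by
    rintro rfl
    simp at h
  obtain ⟨i, hi⟩ := Finsupp.ne_iff.mp h0
  have hle : Finsupp.single i 1 ≤ m := by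
    rw [Finsupp.single_le_iff]
    exact Nat.one_le_iff_ne_zero.mpr hi
  have hm : m = Finsupp.single i 1 + (m - Finsupp.single i 1) := (add_tsub_cancel_of_le hle).symm
  refine ⟨i, m - Finsupp.single i 1, hm, ?_⟩
  have := congrArg Finsupp.degree hm
  rw [map_add, h, Finsupp.degree_single] at this
  omega

lemma tensor_form {k : Type*} [Field k] (F : MvPolynomial (Fin 4) k) (hF : F.IsHomogeneous 3) :
    ∃ T : Fin 4 → Fin 4 → Fin 4 → k, F = ∑ i, ∑ j, ∑ l, C (T i j l) * (X i * X j * X l) := by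
  classical
  let S : Submodule k (MvPolynomial (Fin 4) k) :=
    { carrier := {p | ∃ T : Fin 4 → Fin 4 → Fin 4 → k,
        p = ∑ i, ∑ j, ∑ l, C (T i j l) * (X i * X j * X l)}
      zero_mem' := ⟨0, by simp⟩
      add_mem' := by
        rintro p q ⟨T, rfl⟩ ⟨U, rfl⟩
        exact ⟨T + U, by simp [Finset.sum_add_distrib, add_mul]⟩
      smul_mem' := by
        rintro c p ⟨T, rfl⟩
        refine ⟨fun i j l => c * T i j l, ?_⟩
        simp [smul_eq_C_mul, Finset.mul_sum, mul_assoc] }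
  change F ∈ S
  rw [← F.support_sum_monomial_coeff]
  refine Submodule.sum_mem _ fun m hm => ?_
  have hd : m.degree = 3 := by
    have := hF (mem_support_iff.mp hm)
    rw [Finsupp.degree_eq_weight_one]
    exact this
  obtain ⟨i, m1, rfl, h1⟩ := finsupp_split m 2 hd
  obtain ⟨j, m2, rfl, h2⟩ := finsupp_split m1 1 h1
  obtain ⟨l, m3, rfl, h3⟩ := finsupp_split m2 0 h2
  rw [Finsupp.degree_eq_zero_iff] at h3
  subst h3
  generalize coeff _ F = c
  refine ⟨fun i' j' l' => if i' = i then if j' = j then if l' = l then c else 0 else 0 else 0, ?_⟩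
  have e : (monomial (Finsupp.single i 1 + (Finsupp.single j 1 + (Finsupp.single l 1 + 0)))) c
      = C c * (X i * X j * X l) := by
    rw [C_mul', add_zero, X, X, X, monomial_mul, monomial_mul, smul_monomial]
    simp [add_assoc]
  rw [e, Finset.sum_eq_single i, Finset.sum_eq_single j, Finset.sum_eq_single l] <;>
    simp +contextual

lemma explicit_form {k : Type*} [Field k] (F : MvPolynomial (Fin 4) k) (hF : F.IsHomogeneous 3) :
    ∃ (r l1 l2 l3 : k) (a : Fin 6 → k) (b : Fin 10 → k), F = C r * X 0 ^ 3
      + X 0 ^ 2 * (C l1 * X 1 + C l2 * X 2 + C l3 * X 3)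
      + X 0 * (C (a 0) * X 1 ^ 2 + C (a 1) * X 1 * X 2 + C (a 2) * X 1 * X 3 + C (a 3) * X 2 ^ 2
        + C (a 4) * X 2 * X 3 + C (a 5) * X 3 ^ 2)
      + (C (b 0) * X 1 ^ 3 + C (b 1) * X 1 ^ 2 * X 2 + C (b 2) * X 1 ^ 2 * X 3
        + C (b 3) * X 1 * X 2 ^ 2 + C (b 4) * X 1 * X 2 * X 3 + C (b 5) * X 1 * X 3 ^ 2
        + C (b 6) * X 2 ^ 3 + C (b 7) * X 2 ^ 2 * X 3 + C (b 8) * X 2 * X 3 ^ 2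
        + C (b 9) * X 3 ^ 3) := by
  obtain ⟨T, rfl⟩ := tensor_form F hF
  refine ⟨T 0 0 0, T 0 0 1 + T 0 1 0 + T 1 0 0, T 0 0 2 + T 0 2 0 + T 2 0 0,
    T 0 0 3 + T 0 3 0 + T 3 0 0,
    ![T 0 1 1 + T 1 0 1 + T 1 1 0,
      T 0 1 2 + T 0 2 1 + T 1 0 2 + T 1 2 0 + T 2 0 1 + T 2 1 0,
      T 0 1 3 + T 0 3 1 + T 1 0 3 + T 1 3 0 + T 3 0 1 + T 3 1 0,
      T 0 2 2 + T 2 0 2 + T 2 2 0,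
      T 0 2 3 + T 0 3 2 + T 2 0 3 + T 2 3 0 + T 3 0 2 + T 3 2 0,
      T 0 3 3 + T 3 0 3 + T 3 3 0],
    ![T 1 1 1, T 1 1 2 + T 1 2 1 + T 2 1 1, T 1 1 3 + T 1 3 1 + T 3 1 1,
      T 1 2 2 + T 2 1 2 + T 2 2 1,
      T 1 2 3 + T 1 3 2 + T 2 1 3 + T 2 3 1 + T 3 1 2 + T 3 2 1,
      T 1 3 3 + T 3 1 3 + T 3 3 1,
      T 2 2 2, T 2 2 3 + T 2 3 2 + T 3 2 2, T 2 3 3 + T 3 2 3 + T 3 3 2, T 3 3 3], ?_⟩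
  simp only [Fin.sum_univ_four]
  simp only [Matrix.cons_val, map_add]
  ring

lemma chain_rule {k σ τ : Type*} [Field k] [Fintype σ] (g : σ → MvPolynomial τ k)
    (F : MvPolynomial σ k) (j : τ) :
    pderiv j (aeval g F) = ∑ i, aeval g (pderiv i F) * pderiv j (g i) := by
  classical
  induction F using MvPolynomial.induction_on with
  | C c => simp
  | add p q hp hq => simp only [map_add, hp, hq, add_mul, Finset.sum_add_distrib]
  | mul_X p n hp =>
    simp only [map_mul, pderiv_mul, aeval_X, hp, map_add, add_mul, Finset.sum_add_distrib,
      pderiv_X, Finset.sum_mul]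
    congr 1
    · exact Finset.sum_congr rfl fun i _ => by ring
    · rw [Finset.sum_eq_single n] <;> simp +contextual [eq_comm]

lemma lin_alg {k : Type*} [Field k] (P : Fin 4 → k) (hP : P ≠ 0) (g : (Fin 4 → k) →ₗ[k] k)
    (hg : g ≠ 0) (hgP : g P = 0) :
    ∃ e : (Fin 4 → k) ≃ₗ[k] (Fin 4 → k), e (Pi.single 0 1) = P ∧ ∀ x, g (e x) = x 1 := by
  obtain ⟨φ, hφ⟩ := Module.Projective.exists_dual_eq_one k hP
  obtain ⟨w, hw⟩ : ∃ w, g w ≠ 0 := by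
    by_contra h
    push Not at h
    exact hg (LinearMap.ext h)
  obtain ⟨v, hv, hφv⟩ : ∃ v, g v = 1 ∧ φ v = 0 := by
    refine ⟨(g w)⁻¹ • (w - φ w • P), ?_, ?_⟩
    · simp [hgP, hw]
    · simp [hφ]
  let ψ : (Fin 4 → k) →ₗ[k] k × k := φ.prod g
  have hsurj : LinearMap.range ψ = ⊤ := by
    rw [LinearMap.range_eq_top]
    rintro ⟨s, t⟩
    refine ⟨s • P + t • v, ?_⟩
    simp [ψ, hφ, hφv, hgP, hv]
  have hrank : Module.finrank k (LinearMap.ker ψ) = 2 := by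
    have := LinearMap.finrank_range_add_finrank_ker ψ
    rw [hsurj, finrank_top] at this
    simp at this
    omega
  let u := Module.finBasisOfFinrankEq k (LinearMap.ker ψ) hrank
  have hu : ∀ i, φ (u i : Fin 4 → k) = 0 ∧ g (u i : Fin 4 → k) = 0 := by
    intro i
    have h := (u i).2
    rw [LinearMap.mem_ker] at h
    exact ⟨congrArg Prod.fst h, congrArg Prod.snd h⟩
  let f : (Fin 4 → k) →ₗ[k] (Fin 4 → k) :=
    (LinearMap.proj 0).smulRight P + (LinearMap.proj 1).smulRight v
      + (LinearMap.proj 2).smulRight (u 0 : Fin 4 → k) + (LinearMap.proj 3).smulRight (u 1 : Fin 4 → k)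
  have hf : ∀ x, f x = x 0 • P + x 1 • v + x 2 • (u 0 : Fin 4 → k) + x 3 • (u 1 : Fin 4 → k) :=
    fun x => rfl
  have hgf : ∀ x, g (f x) = x 1 := by
    intro x
    simp [hf, hgP, hv, (hu 0).2, (hu 1).2]
  have hφf : ∀ x, φ (f x) = x 0 := by
    intro x
    simp [hf, hφ, hφv, (hu 0).1, (hu 1).1]
  have hinj : Function.Injective f := by
    rw [← LinearMap.ker_eq_bot, LinearMap.ker_eq_bot']
    intro x hx
    have h1 : x 1 = 0 := by rw [← hgf x, hx, map_zero]
    have h0 : x 0 = 0 := by rw [← hφf x, hx, map_zero]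
    have hh : x 2 • u 0 + x 3 • u 1 = 0 := by
      apply Subtype.ext
      have := hf x
      rw [hx, h0, h1] at this
      simpa using this.symm
    have hli := Fintype.linearIndependent_iff.mp u.linearIndependent ![x 2, x 3] (by
      simpa [Fin.sum_univ_two] using hh)
    have h2 : x 2 = 0 := hli 0
    have h3 : x 3 = 0 := hli 1
    funext i
    fin_cases i <;> assumption
  refine ⟨LinearEquiv.ofInjectiveEndo f hinj, ?_, hgf⟩
  change f _ = P
  simp [hf]

lemma coeff_explicit {k : Type*} [Field k] (α β γ : k) :
    (C α * X 0 ^ 2 * X 1 + C β * X 0 * X 1 ^ 2 + C γ * X 1 ^ 3 : MvPolynomial (Fin 2) k).coeff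
      (Finsupp.single 0 2 + Finsupp.single 1 1) = α ∧
    (C α * X 0 ^ 2 * X 1 + C β * X 0 * X 1 ^ 2 + C γ * X 1 ^ 3 : MvPolynomial (Fin 2) k).coeff
      (Finsupp.single 0 1 + Finsupp.single 1 2) = β := by
  classical
  have e : (C α * X 0 ^ 2 * X 1 + C β * X 0 * X 1 ^ 2 + C γ * X 1 ^ 3 : MvPolynomial (Fin 2) k)
      = monomial (Finsupp.single 0 2 + Finsupp.single 1 1) α
        + monomial (Finsupp.single 0 1 + Finsupp.single 1 2) β + monomial (Finsupp.single 1 3) γ := by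
    simp [monomial_eq, Finsupp.prod_add_index', pow_add, mul_assoc]
  have n1 : (Finsupp.single 0 1 + Finsupp.single 1 2 : Fin 2 →₀ ℕ)
      ≠ Finsupp.single 0 2 + Finsupp.single 1 1 := by
    intro h
    simpa using DFunLike.congr_fun h 0
  have n2 : (Finsupp.single 1 3 : Fin 2 →₀ ℕ) ≠ Finsupp.single 0 2 + Finsupp.single 1 1 := by
    intro h
    simpa using DFunLike.congr_fun h 0
  have n3 : (Finsupp.single 1 3 : Fin 2 →₀ ℕ) ≠ Finsupp.single 0 1 + Finsupp.single 1 2 := by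
    intro h
    simpa using DFunLike.congr_fun h 0
  rw [e]
  simp only [coeff_add, coeff_monomial, if_neg n1, if_neg n1.symm, if_neg n2, if_neg n3, if_true]
  simp

end CubicTransfer

lemma real_bound (N Q : ℕ) (hQ : 2 ≤ Q) (h : N * (Q - 1) ≤ 8 * Q ^ 2) :
    (N : ℝ) ≤ 9 * Q + 56 * Real.sqrt Q + 9 := by
  obtain ⟨m, rfl⟩ : ∃ m, Q = m + 2 := ⟨Q - 2, by omega⟩
  have h' : (N : ℝ) * (m + 1) ≤ 8 * (m + 2) ^ 2 := by
    have : m + 2 - 1 = m + 1 := by omega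
    rw [this] at h
    exact_mod_cast h
  have hs : (1 : ℝ) ≤ Real.sqrt ((m + 2 : ℕ) : ℝ) := by
    rw [Real.one_le_sqrt]
    push_cast
    have : (0 : ℝ) ≤ m := Nat.cast_nonneg m
    linarith
  have hm : (0 : ℝ) ≤ m := Nat.cast_nonneg m
  push_cast at *
  by_contra hc
  push Not at hc
  have : (9 * ((m : ℝ) + 2) + 56 + 9) * (m + 1) < N * (m + 1) :=
    mul_lt_mul_of_pos_right (by linarith) (by linarith)
  nlinarith

/-- Over the finite field with `Q` elements, the number of projective points of a smooth
cubic surface `V : F = 0` that are not in general position with a given point `P ∈ V`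
is at most `9Q + 56√Q + 9`. -/
theorem stmt1 {k : Type} [Field k] [Fintype k] (Q : ℕ) (hQ : Fintype.card k = Q)
    (F : MvPolynomial (Fin 4) k) (hF0 : F ≠ 0) (hF3 : F.IsHomogeneous 3)
    (hsm : IsSmoothCubicSurface F)
    (P : Fin 4 → k) (hP0 : P ≠ 0) (hPV : MvPolynomial.eval P F = 0) :
    (Nat.card {x : Projectivization k (Fin 4 → k) //
        MvPolynomial.eval x.rep F = 0 ∧ ¬ InGeneralPosition F P x.rep} : ℝ) ≤
      9 * Q + 56 * Real.sqrt Q + 9 := by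
  classical
  let K := AlgebraicClosure k
  have hae : ∀ (x : Fin 4 → k) (p : MvPolynomial (Fin 4) k), aeval x p = eval x p :=
    fun x p => RingHom.congr_fun (coe_aeval_eq_eval x) p
  -- smoothness in terms of `aeval`
  have hsm' : ∀ x : Fin 4 → K, x ≠ 0 → aeval x F = 0 → (∀ i, aeval x (pderiv i F) = 0) → False := by
    intro x hx h0 h1
    apply hsm x hx
    simp only [eval_map]
    exact ⟨h0, h1⟩
  -- the gradient at `P`
  let g : (Fin 4 → k) →ₗ[k] k := ∑ i, (eval P (pderiv i F)) • LinearMap.proj i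
  have hgx : ∀ x, g x = ∑ i, eval P (pderiv i F) * x i := by
    intro x
    simp [g]
  have hg : g ≠ 0 := by
    intro h
    have hi : ∀ i, eval P (pderiv i F) = 0 := by
      intro i
      have h2 := hgx (Pi.single i 1)
      rw [h] at h2
      simpa [Pi.single_apply] using h2.symm
    refine hsm' (fun i => algebraMap k K (P i)) ?_ ?_ ?_
    · intro h
      apply hP0
      funext i
      have := congrFun h i
      simpa using this
    · have := aeval_algebraMap_apply K P F
      rw [Function.comp_def] at this
      rw [this, hae, hPV, map_zero]
    · intro i
      have := aeval_algebraMap_apply K P (pderiv i F)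
      rw [Function.comp_def] at this
      rw [this, hae, hi, map_zero]
  have hgP : g P = 0 := by
    have h := congrArg (eval P) hF3.sum_X_mul_pderiv
    rw [hgx]
    simp [hPV] at h
    rw [← h]
    exact Finset.sum_congr rfl fun i _ => mul_comm _ _
  obtain ⟨e, he0, heg⟩ := lin_alg P hP0 g hg hgP
  let A := LinearMap.toMatrix' (e : (Fin 4 → k) →ₗ[k] (Fin 4 → k))
  let B := LinearMap.toMatrix' (e.symm : (Fin 4 → k) →ₗ[k] (Fin 4 → k))
  have hAB : A * B = 1 := by
    simp only [A, B]
    rw [← LinearMap.toMatrix'_comp]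
    simp
  have hBA : B * A = 1 := by
    simp only [A, B]
    rw [← LinearMap.toMatrix'_comp]
    simp
  have heA : ∀ x i, e x i = ∑ j, A i j * x j := by
    intro x i
    have : e x = A.mulVec x := by
      simp only [A]
      rw [LinearMap.toMatrix'_mulVec]
      rfl
    rw [this]
    rfl
  let G : Fin 4 → MvPolynomial (Fin 4) k := fun i => ∑ j, C (A i j) * X j
  let F' := aeval G F
  have hcomp : ∀ (R : Type) [CommRing R] [Algebra k R] (p : MvPolynomial (Fin 4) k) (x : Fin 4 → R),
      aeval x (aeval G p) = aeval (fun i => ∑ j, algebraMap k R (A i j) * x j) p := by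
    intro R _ _ p x
    induction p using MvPolynomial.induction_on with
    | C c => simp
    | add p q hp hq => simp only [map_add, hp, hq]
    | mul_X p n hp => simp only [map_mul, hp, aeval_X]; simp [G]
  have hGd : ∀ i j, pderiv j (G i) = C (A i j) := by
    intro i j
    simp only [G, map_sum, pderiv_C_mul, pderiv_X]
    rw [Finset.sum_eq_single j] <;> simp +contextual [Pi.single_apply]
  have hd : ∀ j, pderiv j F' = ∑ i, aeval G (pderiv i F) * C (A i j) := by
    intro j
    simp only [F', chain_rule, hGd]
  have hF'3 : F'.IsHomogeneous 3 := by
    have := hF3.aeval (n := 1) G (fun i => by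
      refine IsHomogeneous.sum _ _ _ fun j _ => ?_
      exact (isHomogeneous_C _ _).mul (isHomogeneous_X _ _))
    exact this
  -- smoothness of `F'`
  have hsF' : ∀ x : Fin 4 → K, x ≠ 0 → aeval x F' = 0 → (∀ i, aeval x (pderiv i F') = 0) → False := by
    intro x hx h0 h1
    refine hsm' (fun i => ∑ j, algebraMap k K (A i j) * x j) ?_ ?_ ?_
    · intro h
      apply hx
      have h2 : (A.map (algebraMap k K)).mulVec x = 0 := h
      have h3 : (B.map (algebraMap k K)) * (A.map (algebraMap k K)) = 1 := by
        rw [← Matrix.map_mul, hBA]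
        simp
      have h4 := congrArg ((B.map (algebraMap k K)).mulVec) h2
      rwa [Matrix.mulVec_mulVec, h3, Matrix.one_mulVec, Matrix.mulVec_zero] at h4
    · rw [← hcomp K F x]
      exact h0
    · set y : Fin 4 → K := fun i => aeval (fun i => ∑ j, algebraMap k K (A i j) * x j) (pderiv i F)
        with hy
      have h2 : Matrix.vecMul y (A.map (algebraMap k K)) = 0 := by
        funext j
        have := h1 j
        rw [hd, map_sum] at this
        simp only [map_mul, hcomp, algHom_C] at this
        exact this
      have h3 : (A.map (algebraMap k K)) * (B.map (algebraMap k K)) = 1 := by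
        rw [← Matrix.map_mul, hAB]
        simp
      have h4 : Matrix.vecMul (Matrix.vecMul y (A.map (algebraMap k K))) (B.map (algebraMap k K))
          = 0 := by
        rw [h2, Matrix.zero_vecMul]
      rw [Matrix.vecMul_vecMul, h3, Matrix.vecMul_one] at h4
      exact fun i => congrFun h4 i
  have hevF' : ∀ x, eval x F' = eval (e x) F := by
    intro x
    have := hcomp k F x
    rw [hae, hae] at this
    rw [show e x = fun i => ∑ j, A i j * x j from funext (heA x)]
    exact this
  obtain ⟨r, l1, l2, l3, a, b, hexp⟩ := explicit_form F' hF'3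
  have hr : r = 0 := by
    have h := hevF' (Pi.single 0 1)
    rw [he0, hPV, hexp] at h
    simpa using h
  have hl : ∀ j, eval (Pi.single 0 1) (pderiv j F') = (Pi.single j 1 : Fin 4 → k) 1 := by
    intro j
    rw [← heg (Pi.single j 1), hgx, hd, map_sum]
    refine Finset.sum_congr rfl fun i _ => ?_
    have h1 := hcomp k (pderiv i F) (Pi.single 0 1)
    rw [hae, hae] at h1
    have h2 : (fun i => ∑ j, algebraMap k k (A i j) * (Pi.single 0 1 : Fin 4 → k) j) = P := by
      rw [← he0]
      funext i
      rw [heA]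
      rfl
    rw [map_mul, eval_C, heA]
    congr 1
    · rw [← h2]; exact h1
    · simp [Pi.single_apply]
  have hl1 : l1 = 1 := by
    have h := hl 1
    rw [hexp] at h
    simpa [pderiv_X] using h
  have hl2 : l2 = 0 := by
    have h := hl 2
    rw [hexp] at h
    simpa [pderiv_X] using h
  have hl3 : l3 = 0 := by
    have h := hl 3
    rw [hexp] at h
    simpa [pderiv_X] using h
  subst hr hl1 hl2 hl3
  simp only [map_zero, map_one, zero_mul, zero_add, add_zero, one_mul] at hexp
  have hES : ExplSmooth (fun i => algebraMap k K (a i)) (fun i => algebraMap k K (b i)) := by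
    intro t x y z h0 e1 e2 e3 e4 e5
    refine hsF' ![t, x, y, z] ?_ ?_ ?_
    · intro h
      have k0 : t = 0 := congrFun h 0
      have k1 : x = 0 := congrFun h 1
      have k2 : y = 0 := congrFun h 2
      have k3 : z = 0 := congrFun h 3
      tauto
    · rw [hexp]
      simp
      linear_combination e1
    · intro i
      rw [hexp]
      fin_cases i
      · simp [pderiv_X]
        linear_combination e2
      · simp [pderiv_X]
        linear_combination e3
      · simp [pderiv_X]
        linear_combination e4
      · simp [pderiv_X]
        linear_combination e5
  -- general position
  have hbad : ∀ x, (eval (e x) F = 0 ∧ ¬ InGeneralPosition F P (e x)) → Bad a b x := by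
    rintro x ⟨hx, hgp⟩
    have hx' : x 0 ^ 2 * x 1 + x 0 * eval ![x 1, x 2, x 3] (qPol a)
        + eval ![x 1, x 2, x 3] (cPol b) = 0 := by
      rw [← hevF', hexp] at hx
      simp at hx
      simp [qPol, cPol]
      linear_combination hx
    refine ⟨hx', ?_⟩
    by_contra hcon
    push Not at hcon
    apply hgp
    have key : MvPolynomial.eval₂ MvPolynomial.C
      (fun i => MvPolynomial.C (P i) * MvPolynomial.X 0 +
        MvPolynomial.C (e x i) * MvPolynomial.X (1 : Fin 2)) F
      = C (x 1) * X 0 ^ 2 * X 1 + C (2 * x 0 * x 1 + eval ![x 1, x 2, x 3] (qPol a)) * X 0 * X 1 ^ 2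
        + C (0 : k) * X 1 ^ 3 := by
      have h1 := hcomp (MvPolynomial (Fin 2) k) F
        (fun j => C ((Pi.single 0 1 : Fin 4 → k) j) * X 0 + C (x j) * X 1)
      have h2 : (fun i => ∑ j, algebraMap k (MvPolynomial (Fin 2) k) (A i j) *
          (C ((Pi.single 0 1 : Fin 4 → k) j) * X 0 + C (x j) * X 1))
          = fun i => C (P i) * X 0 + C (e x i) * X 1 := by
        funext i
        rw [← he0, heA, heA, map_sum, map_sum, Finset.sum_mul, Finset.sum_mul,
          ← Finset.sum_add_distrib]
        refine Finset.sum_congr rfl fun j _ => ?_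
        rw [algebraMap_eq, C_mul, C_mul]
        ring
      rw [h2] at h1
      change aeval (fun i => C (P i) * X 0 + C (e x i) * X 1) F = _
      rw [← h1, ← hx']
      change aeval _ F' = _
      rw [hexp]
      have hC2 : (C 2 : MvPolynomial (Fin 2) k) = 2 := map_ofNat C 2
      simp [qPol, cPol, hC2]
      ring
    unfold InGeneralPosition
    rw [key, (coeff_explicit _ _ _).1, (coeff_explicit _ _ _).2]
    exact hcon
  have hbads : ∀ (u : k) x, Bad a b x → Bad a b (u • x) := by
    rintro u x ⟨h1, h2⟩
    simp [qPol, cPol] at h1 h2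
    constructor
    · simp [qPol, cPol]
      linear_combination u ^ 3 * h1
    · rcases h2 with h2 | h2
      · left
        simp [h2]
      · right
        simp [qPol]
        linear_combination u ^ 2 * h2
  have hcount := bad_count (K := K) a b hES
  -- counting
  let S := {x : Projectivization k (Fin 4 → k) //
        MvPolynomial.eval x.rep F = 0 ∧ ¬ InGeneralPosition F P x.rep}
  have hle : Nat.card (S × kˣ) ≤ Nat.card {v : Fin 4 → k // Bad a b v} := by
    refine Nat.card_le_card_of_injective
      (fun s => ⟨(s.2 : k) • e.symm s.1.1.rep, hbads _ _ (hbad _ (by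
        rw [e.apply_symm_apply]; exact s.1.2))⟩) ?_
    rintro ⟨⟨x, hx⟩, u⟩ ⟨⟨y, hy⟩, w⟩ h
    have h1 : (u : k) • e.symm x.rep = (w : k) • e.symm y.rep := congrArg Subtype.val h
    have h2 : (u : k) • x.rep = (w : k) • y.rep := by
      have := congrArg e h1
      simpa using this
    have hxy : x = y := by
      rw [← x.mk_rep, ← y.mk_rep, Projectivization.mk_eq_mk_iff]
      refine ⟨u⁻¹ * w, ?_⟩
      rw [mul_smul, Units.smul_def w, ← h2, ← Units.smul_def, inv_smul_smul]
    subst hxy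
    have huw : u = w := by
      have h3 : ((u : k) - w) • x.rep = 0 := by rw [sub_smul, h2, sub_self]
      rcases smul_eq_zero.mp h3 with h4 | h4
      · exact Units.ext (sub_eq_zero.mp h4)
      · exact absurd h4 x.rep_nonzero
    rw [huw]
  rw [Nat.card_prod, Nat.card_units, Nat.card_eq_fintype_card (α := k)] at hle
  have hQ2 : 2 ≤ Q := by
    rw [← hQ]
    exact Fintype.one_lt_card
  refine real_bound _ Q hQ2 ?_
  rw [← hQ]
  exact hle.trans hcount
end
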